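/- arXiv:1408.6625 — 9 statements merged into one kernel-verified Lean document; each statement's English description precedes it below -/
import Mathlib

section
/- Let T > 0 and let f, ρ : [0,T) × [0,1] → ℝ be continuously differentiable, with ρ_t(t,x) + f(t,x) ρ_x(t,x) = ρ(t,x) f_x(t,x) for all (t,x) ∈ [0,T) × [0,1], and f(t,0) = f(t,1) = 0 for all t ∈ [0,T). Then for every t ∈ [0,T), sup_{x∈[0,1]} |ρ(t,x)| ≤ (sup_{x∈[0,1]} |ρ(0,x)|) · exp(∫₀ᵗ sup_{x∈[0,1]} |f_x(s,x)| ds). -/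
open Set MeasureTheory

/-- A solution of `u_t + f u_x = u f_x` on `[0,t] × [0,1]`, where `f` vanishes at both ends of
`[0,1]`, stays strictly below any positive `w` with `w' > f_x w` and `u(0,·) < w(0)`. -/
lemma transport_lt_of_strict_supersolution {t : ℝ} {f u fx ut ux : ℝ → ℝ → ℝ} {w w' : ℝ → ℝ}
    (hux : ∀ s ∈ Icc (0 : ℝ) t, ∀ x ∈ Icc (0 : ℝ) 1, HasDerivAt (u s) (ux s x) x)
    (hut : ∀ s ∈ Icc (0 : ℝ) t, ∀ x ∈ Icc (0 : ℝ) 1, HasDerivAt (fun r => u r x) (ut s x) s)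
    (hcu : ContinuousOn (fun p : ℝ × ℝ => u p.1 p.2) (Icc (0 : ℝ) t ×ˢ Icc (0 : ℝ) 1))
    (hpde : ∀ s ∈ Icc (0 : ℝ) t, ∀ x ∈ Icc (0 : ℝ) 1, ut s x + f s x * ux s x = u s x * fx s x)
    (hbc : ∀ s ∈ Icc (0 : ℝ) t, f s 0 = 0 ∧ f s 1 = 0)
    (hw : ∀ s, HasDerivAt w (w' s) s)
    (hww' : ∀ s ∈ Icc (0 : ℝ) t, ∀ x ∈ Icc (0 : ℝ) 1, w s * fx s x < w' s)
    (h0 : ∀ x ∈ Icc (0 : ℝ) 1, u 0 x < w 0) :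
    ∀ s ∈ Icc (0 : ℝ) t, ∀ x ∈ Icc (0 : ℝ) 1, u s x < w s := by
  by_contra! hcon
  obtain ⟨r, hr, y, hy, hry⟩ := hcon
  have hcw : Continuous w := continuous_iff_continuousAt.2 fun s => (hw s).continuousAt
  let S : Set (ℝ × ℝ) := {p ∈ Icc (0 : ℝ) t ×ˢ Icc (0 : ℝ) 1 | w p.1 ≤ u p.1 p.2}
  have hS : IsCompact S := by
    have hK : IsCompact (Icc (0 : ℝ) t ×ˢ Icc (0 : ℝ) 1) := isCompact_Icc.prod isCompact_Icc
    exact hK.of_isClosed_subset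
      (hK.isClosed.isClosed_le (hcw.comp continuous_fst).continuousOn hcu) fun p hp => hp.1
  obtain ⟨⟨s, x⟩, ⟨⟨hs, hx⟩, hle⟩, hmin⟩ :=
    hS.exists_isMinOn ⟨(r, y), ⟨hr, hy⟩, hry⟩ continuous_fst.continuousOn
  simp only at hs hx hle
  have hs0 : 0 < s := by
    refine lt_of_le_of_ne hs.1 fun h => ?_
    subst h
    exact (h0 x hx).not_ge hle
  have hbefore : ∀ z ∈ Icc (0 : ℝ) 1, ∀ q ∈ Ico 0 s, u q z < w q := by
    intro z hz q hq
    by_contra! h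
    exact hq.2.not_ge (hmin (a := (q, z)) ⟨⟨⟨hq.1, hq.2.le.trans hs.2⟩, hz⟩, h⟩)
  have hev : ∀ᶠ q in nhdsWithin s (Iio s), q ∈ Ico 0 s := Ico_mem_nhdsLT hs0
  have hat : ∀ z ∈ Icc (0 : ℝ) 1, u s z ≤ w s := by
    intro z hz
    refine le_of_tendsto_of_tendsto (b := nhdsWithin s (Iio s))
      ((hut s hs z hz).continuousAt.tendsto.mono_left nhdsWithin_le_nhds)
      (hcw.continuousAt.tendsto.mono_left nhdsWithin_le_nhds) ?_
    filter_upwards [hev] with q hq using (hbefore z hz q hq).le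
  have heq : u s x = w s := le_antisymm (hat x hx) hle
  have hflux : f s x * ux s x = 0 := by
    rcases hx.1.eq_or_lt with h | hx0
    · rw [← h, (hbc s hs).1, zero_mul]
    rcases hx.2.eq_or_lt with h | hx1
    · rw [h, (hbc s hs).2, zero_mul]
    have hmax : IsLocalMax (u s) x := by
      filter_upwards [Icc_mem_nhds hx0 hx1] with z hz
      exact (hat z hz).trans heq.ge
    rw [hmax.hasDerivAt_eq_zero (hux s hs x hx), mul_zero]
  have hslope : w' s - ut s x ≤ 0 := by
    have hd := (hasDerivAt_iff_tendsto_slope.1 ((hw s).sub (hut s hs x hx))).mono_left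
      (nhdsWithin_mono s (show Iio s ⊆ {s}ᶜ from fun q hq => ne_of_lt hq))
    refine le_of_tendsto hd ?_
    filter_upwards [hev] with q hq
    have hb := hbefore x hx q hq
    rw [slope_def_field]
    refine div_nonpos_of_nonneg_of_nonpos ?_ (by linarith [hq.2])
    simp only [Pi.sub_apply]
    linarith
  have h1 := hpde s hs x hx
  have h2 := hww' s hs x hx
  rw [heq] at h1
  linarith

/-- Exponential bound for solutions of `u_t + f u_x = u f_x` in terms of an upper bound of `f_x`. -/
lemma transport_le_mul_exp_integral {t M : ℝ} {f u fx ut ux : ℝ → ℝ → ℝ} {A : ℝ → ℝ}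
    (hux : ∀ s ∈ Icc (0 : ℝ) t, ∀ x ∈ Icc (0 : ℝ) 1, HasDerivAt (u s) (ux s x) x)
    (hut : ∀ s ∈ Icc (0 : ℝ) t, ∀ x ∈ Icc (0 : ℝ) 1, HasDerivAt (fun r => u r x) (ut s x) s)
    (hcu : ContinuousOn (fun p : ℝ × ℝ => u p.1 p.2) (Icc (0 : ℝ) t ×ˢ Icc (0 : ℝ) 1))
    (hpde : ∀ s ∈ Icc (0 : ℝ) t, ∀ x ∈ Icc (0 : ℝ) 1, ut s x + f s x * ux s x = u s x * fx s x)
    (hbc : ∀ s ∈ Icc (0 : ℝ) t, f s 0 = 0 ∧ f s 1 = 0)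
    (hA : Continuous A) (hfxA : ∀ s ∈ Icc (0 : ℝ) t, ∀ x ∈ Icc (0 : ℝ) 1, fx s x ≤ A s)
    (hM : 0 ≤ M) (h0 : ∀ x ∈ Icc (0 : ℝ) 1, u 0 x ≤ M) :
    ∀ s ∈ Icc (0 : ℝ) t, ∀ x ∈ Icc (0 : ℝ) 1, u s x ≤ M * Real.exp (∫ r in (0 : ℝ)..s, A r) := by
  intro s hs x hx
  have hε : ∀ ε > 0, u s x ≤ (M + ε) * Real.exp ((∫ r in (0 : ℝ)..s, A r) + ε * s) := by
    intro ε hε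
    have hw : ∀ q, HasDerivAt
        (fun q => (M + ε) * Real.exp ((∫ r in (0 : ℝ)..q, A r) + ε * q))
        ((M + ε) * (Real.exp ((∫ r in (0 : ℝ)..q, A r) + ε * q) * (A q + ε * 1))) q := fun q =>
      (((hA.integral_hasStrictDerivAt 0 q).hasDerivAt.add
        ((hasDerivAt_id q).const_mul ε)).exp).const_mul (M + ε)
    refine (transport_lt_of_strict_supersolution hux hut hcu hpde hbc hw ?_ ?_ s hs x hx).le
    · intro q hq y hy
      rw [← mul_assoc]
      have := hfxA q hq y hy
      exact mul_lt_mul_of_pos_left (by linarith) (by positivity)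
    · intro y hy
      simpa using (h0 y hy).trans_lt (by linarith)
  have hlim : Filter.Tendsto
      (fun ε : ℝ => (M + ε) * Real.exp ((∫ r in (0 : ℝ)..s, A r) + ε * s))
      (nhdsWithin 0 (Ioi 0)) (nhds (M * Real.exp (∫ r in (0 : ℝ)..s, A r))) := by
    have hc : Continuous
        (fun ε : ℝ => (M + ε) * Real.exp ((∫ r in (0 : ℝ)..s, A r) + ε * s)) := by fun_prop
    simpa using (hc.tendsto 0).mono_left nhdsWithin_le_nhds
  refine ge_of_tendsto hlim ?_
  filter_upwards [self_mem_nhdsWithin] with ε h using hε ε h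

/-- The spatial sup norm over `[0,1]` of a function continuous on `[0,t] × [0,1]`, with time
clamped to `[0,t]`, is continuous in time. -/
lemma continuous_iSup_abs_projIcc {t : ℝ} (ht : 0 ≤ t) {g : ℝ → ℝ → ℝ}
    (hg : ContinuousOn (fun p : ℝ × ℝ => g p.1 p.2) (Icc (0 : ℝ) t ×ˢ Icc (0 : ℝ) 1)) :
    Continuous fun s => ⨆ x : Icc (0 : ℝ) 1, |g (projIcc 0 t ht s) x| := by
  have hF : Continuous (Function.uncurry
      fun (s : ℝ) (x : Icc (0 : ℝ) 1) => |g (projIcc 0 t ht s) x|) := by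
    refine Continuous.abs (hg.comp_continuous
      (f := fun p : ℝ × Icc (0 : ℝ) 1 => (((projIcc 0 t ht p.1 : Icc (0 : ℝ) t) : ℝ), (p.2 : ℝ)))
      ?_ fun p => ⟨(projIcc 0 t ht p.1).2, p.2.2⟩)
    exact (continuous_subtype_val.comp (continuous_projIcc.comp continuous_fst)).prodMk
      (continuous_subtype_val.comp continuous_snd)
  simpa only [image_univ, sSup_range] using
    (isCompact_univ (X := Icc (0 : ℝ) 1)).continuous_sSup hF

/-- Values of a function continuous on `[0,t] × [0,1]` are bounded by its spatial sup norm. -/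
lemma abs_le_iSup_abs {t : ℝ} {g : ℝ → ℝ → ℝ}
    (hg : ContinuousOn (fun p : ℝ × ℝ => g p.1 p.2) (Icc (0 : ℝ) t ×ˢ Icc (0 : ℝ) 1))
    {s : ℝ} (hs : s ∈ Icc (0 : ℝ) t) {x : ℝ} (hx : x ∈ Icc (0 : ℝ) 1) :
    |g s x| ≤ ⨆ y : Icc (0 : ℝ) 1, |g s y| := by
  have hc : Continuous fun y : Icc (0 : ℝ) 1 => |g s y| :=
    Continuous.abs (hg.comp_continuous (f := fun y : Icc (0 : ℝ) 1 => (s, (y : ℝ)))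
      (by fun_prop) fun y => ⟨hs, y.2⟩)
  exact le_ciSup (isCompact_range hc).bddAbove (⟨x, hx⟩ : Icc (0 : ℝ) 1)

/-- (Estimate (2.14).) If `f, ρ` are continuously differentiable on
`[0,T) × [0,1]`, satisfy `ρ_t + f ρ_x = ρ f_x`, and `f(t,0) = f(t,1) = 0`, then
`‖ρ(t,·)‖_{L^∞([0,1])} ≤ ‖ρ(0,·)‖_{L^∞([0,1])} exp(∫₀ᵗ ‖f_x(s,·)‖_{L^∞([0,1])} ds)`. -/
theorem stmt4 (T : ℝ) (hT : 0 < T)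
    (f ρ fx ρt ρx : ℝ → ℝ → ℝ)
    (hfx : ∀ t ∈ Ico (0:ℝ) T, ∀ x ∈ Icc (0:ℝ) 1, HasDerivAt (f t) (fx t x) x)
    (hρx : ∀ t ∈ Ico (0:ℝ) T, ∀ x ∈ Icc (0:ℝ) 1, HasDerivAt (ρ t) (ρx t x) x)
    (hρt : ∀ t ∈ Ico (0:ℝ) T, ∀ x ∈ Icc (0:ℝ) 1, HasDerivAt (fun s => ρ s x) (ρt t x) t)
    (hcf : ContinuousOn (fun p : ℝ × ℝ => f p.1 p.2) (Ico (0:ℝ) T ×ˢ Icc (0:ℝ) 1))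
    (hcρ : ContinuousOn (fun p : ℝ × ℝ => ρ p.1 p.2) (Ico (0:ℝ) T ×ˢ Icc (0:ℝ) 1))
    (hcfx : ContinuousOn (fun p : ℝ × ℝ => fx p.1 p.2) (Ico (0:ℝ) T ×ˢ Icc (0:ℝ) 1))
    (hcρt : ContinuousOn (fun p : ℝ × ℝ => ρt p.1 p.2) (Ico (0:ℝ) T ×ˢ Icc (0:ℝ) 1))
    (hcρx : ContinuousOn (fun p : ℝ × ℝ => ρx p.1 p.2) (Ico (0:ℝ) T ×ˢ Icc (0:ℝ) 1))
    (hpde : ∀ t ∈ Ico (0:ℝ) T, ∀ x ∈ Icc (0:ℝ) 1,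
      ρt t x + f t x * ρx t x = ρ t x * fx t x)
    (hbc : ∀ t ∈ Ico (0:ℝ) T, f t 0 = 0 ∧ f t 1 = 0) :
    ∀ t ∈ Ico (0:ℝ) T,
      (⨆ x : Icc (0:ℝ) 1, |ρ t x.1|)
        ≤ (⨆ x : Icc (0:ℝ) 1, |ρ 0 x.1|) *
            Real.exp (∫ s in (0:ℝ)..t, ⨆ x : Icc (0:ℝ) 1, |fx s x.1|) := by
  intro t ht
  have hsub : ∀ s ∈ Icc (0 : ℝ) t, s ∈ Ico (0 : ℝ) T := fun s hs => ⟨hs.1, hs.2.trans_lt ht.2⟩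
  have hsub' : Icc (0 : ℝ) t ×ˢ Icc (0 : ℝ) 1 ⊆ Ico (0 : ℝ) T ×ˢ Icc (0 : ℝ) 1 :=
    prod_mono hsub subset_rfl
  have hA := continuous_iSup_abs_projIcc ht.1 (hcfx.mono hsub')
  have hAeq : ∀ s ∈ Icc (0 : ℝ) t, (⨆ x : Icc (0 : ℝ) 1, |fx (projIcc 0 t ht.1 s) x|) =
      ⨆ x : Icc (0 : ℝ) 1, |fx s x| := fun s hs => by rw [projIcc_of_mem ht.1 hs]
  have hint : (∫ s in (0 : ℝ)..t, ⨆ x : Icc (0 : ℝ) 1, |fx (projIcc 0 t ht.1 s) x|) =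
      ∫ s in (0 : ℝ)..t, ⨆ x : Icc (0 : ℝ) 1, |fx s x| :=
    intervalIntegral.integral_congr fun s hs => hAeq s (by rwa [uIcc_of_le ht.1] at hs)
  have hfxA : ∀ s ∈ Icc (0 : ℝ) t, ∀ x ∈ Icc (0 : ℝ) 1,
      fx s x ≤ ⨆ x : Icc (0 : ℝ) 1, |fx (projIcc 0 t ht.1 s) x| := fun s hs x hx =>
    (le_abs_self _).trans ((abs_le_iSup_abs (hcfx.mono hsub') hs hx).trans (hAeq s hs).ge)
  have hM : 0 ≤ ⨆ x : Icc (0 : ℝ) 1, |ρ 0 x| := Real.iSup_nonneg fun x => abs_nonneg _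
  have h0 : ∀ x ∈ Icc (0 : ℝ) 1, |ρ 0 x| ≤ ⨆ x : Icc (0 : ℝ) 1, |ρ 0 x| := fun x hx =>
    abs_le_iSup_abs (hcρ.mono hsub') ⟨le_rfl, ht.1⟩ hx
  rw [← hint]
  refine ciSup_le fun x => abs_le'.2 ⟨?_, ?_⟩
  · exact transport_le_mul_exp_integral (fun s hs => hρx s (hsub s hs))
      (fun s hs => hρt s (hsub s hs)) (hcρ.mono hsub') (fun s hs => hpde s (hsub s hs))
      (fun s hs => hbc s (hsub s hs)) hA hfxA hM
      (fun x hx => (le_abs_self _).trans (h0 x hx)) t ⟨ht.1, le_rfl⟩ x x.2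
  · exact transport_le_mul_exp_integral (u := fun s x => -ρ s x) (ut := fun s x => -ρt s x)
      (ux := fun s x => -ρx s x) (fun s hs x hx => (hρx s (hsub s hs) x hx).neg)
      (fun s hs x hx => (hρt s (hsub s hs) x hx).neg) (hcρ.mono hsub').neg
      (fun s hs x hx => by linarith [hpde s (hsub s hs) x hx])
      (fun s hs => hbc s (hsub s hs)) hA hfxA hM
      (fun x hx => (neg_le_abs _).trans (h0 x hx)) t ⟨ht.1, le_rfl⟩ x x.2
end

section
/- Let T* > 0 and let f, ρ : [0,T*) × [0,1] → ℝ be a classical solution (f three times continuously differentiable in x and once in t with all relevant mixed partials continuous, ρ continuously differentiable) of the system f_{xt} + f f_{xx} - f_x² + ρ = I(t), ρ_t + f ρ_x = ρ f_x on [0,T*) × [0,1], where I(t) = ∫₀¹ ρ(t,x) dx - 2∫₀¹ f_x(t,x)² dx, with Dirichlet boundary conditions f(t,0) = f(t,1) = 0 and ρ(t,0) = ρ(t,1) = 0. If ∫₀^{T*} sup_{x∈[0,1]} |f_x(t,x)| dt < +∞, then sup_{t∈[0,T*)} [ sup_{x∈[0,1]} |f_x(t,x)| + ∫₀¹ ( ρ(t,x)²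 + ρ_x(t,x)² + f_x(t,x)² + f_{xx}(t,x)² ) dx ] < +∞. -/
open Set MeasureTheory

/-- A maximum principle on a compact parameter set: finitely many functions that are nonpositive
initially, and strictly decreasing in time wherever one of them attains a positive joint spatial
maximum, stay nonpositive. -/
theorem nonpos_of_deriv_neg_at_max {ι X : Type*} [Finite ι] [TopologicalSpace X] {K : Set X}
    (hK : IsCompact K) {τ : ℝ} (hτ : 0 ≤ τ) {W : ι → ℝ → X → ℝ}
    (hc : ∀ i, ContinuousOn (fun p : ℝ × X => W i p.1 p.2) (Icc 0 τ ×ˢ K))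
    (h0 : ∀ i, ∀ z ∈ K, W i 0 z ≤ 0)
    (hd : ∀ i, ∀ s ∈ Ioc 0 τ, ∀ z ∈ K, 0 < W i s z →
      (∀ j, ∀ z' ∈ K, W j s z' ≤ W i s z) →
      ∃ d < 0, HasDerivAt (fun r => W i r z) d s) :
    ∀ i, ∀ z ∈ K, W i τ z ≤ 0 := by
  intro i₀ z₀ hz₀
  by_contra! hpos
  have hmax : ∀ i, ∃ p ∈ Icc 0 τ ×ˢ K, IsMaxOn (fun p : ℝ × X => W i p.1 p.2) (Icc 0 τ ×ˢ K) p :=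
    fun i => (isCompact_Icc.prod hK).exists_isMaxOn ⟨(τ, z₀), ⟨hτ, le_rfl⟩, hz₀⟩ (hc i)
  choose p hp hpmax using hmax
  have : Nonempty ι := ⟨i₀⟩
  obtain ⟨i, hi⟩ := Finite.exists_max fun i => W i (p i).1 (p i).2
  have hle : ∀ j, ∀ r ∈ Icc 0 τ, ∀ z ∈ K, W j r z ≤ W i (p i).1 (p i).2 := fun j r hr z hz =>
    (hpmax j (show (r, z) ∈ Icc 0 τ ×ˢ K from ⟨hr, hz⟩)).trans (hi j)
  obtain ⟨⟨hs0, hsτ⟩, hzK⟩ := hp i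
  have hWpos : 0 < W i (p i).1 (p i).2 := hpos.trans_le (hle i₀ τ ⟨hτ, le_rfl⟩ z₀ hz₀)
  have hspos : 0 < (p i).1 := by
    refine lt_of_le_of_ne hs0 fun h => ?_
    have := h0 i _ hzK
    exact absurd ((congrArg (W i · (p i).2) h.symm).le.trans this) hWpos.not_ge
  obtain ⟨d, hd0, hder⟩ := hd i _ ⟨hspos, hsτ⟩ _ hzK hWpos
    fun j z' hz' => hle j _ ⟨hs0, hsτ⟩ z' hz'
  have hev := (hasDerivAt_iff_tendsto_slope_left_right.1 hder).1.eventually_lt_const hd0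
  obtain ⟨r, hr, hrI⟩ := (hev.and (Ioo_mem_nhdsLT hspos)).exists
  rw [slope_def_field, div_lt_iff_of_neg (by linarith [hrI.2])] at hr
  linarith [hle i r ⟨hrI.1.le, hrI.2.le.trans hsτ⟩ _ hzK]

/-- If `v x - v y - N |x - y|` is maximal on the unit square at `(x, y)` off the diagonal, then
transport by a Lipschitz velocity `φ` vanishing at both endpoints costs at most `N m |x - y|`. -/
theorem transport_lower_bound_at_max {v v' φ : ℝ → ℝ} {N m x y : ℝ} (hN : 0 ≤ N)
    (hv : ∀ x ∈ Icc (0 : ℝ) 1, HasDerivAt v (v' x) x) (hφ0 : φ 0 = 0) (hφ1 : φ 1 = 0)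
    (hφ : |φ x - φ y| ≤ m * |x - y|) (hx : x ∈ Icc (0 : ℝ) 1) (hy : y ∈ Icc (0 : ℝ) 1)
    (hxy : x ≠ y)
    (hmax : ∀ x' ∈ Icc (0 : ℝ) 1, ∀ y' ∈ Icc (0 : ℝ) 1,
      v x' - v y' - N * |x' - y'| ≤ v x - v y - N * |x - y|) :
    -(N * (m * |x - y|)) ≤ φ x * v' x - φ y * v' y := by
  obtain ⟨g, hg, hgx, hgy⟩ : ∃ g : ℝ, |g| = 1 ∧ HasDerivAt (fun a => |a - y|) g x ∧
      HasDerivAt (fun a => |x - a|) (-g) y := by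
    rcases hxy.lt_or_gt with h | h
    · refine ⟨-1, by simp, ?_, ?_⟩
      · simpa [Function.comp_def] using (hasDerivAt_abs_neg (sub_neg.2 h)).comp x ((hasDerivAt_id x).sub_const y)
      · simpa [Function.comp_def] using (hasDerivAt_abs_neg (sub_neg.2 h)).comp y ((hasDerivAt_id y).const_sub x)
    · refine ⟨1, by simp, ?_, ?_⟩
      · simpa [Function.comp_def] using (hasDerivAt_abs_pos (sub_pos.2 h)).comp x ((hasDerivAt_id x).sub_const y)
      · simpa [Function.comp_def] using (hasDerivAt_abs_pos (sub_pos.2 h)).comp y ((hasDerivAt_id y).const_sub x)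
  have hend : ∀ z ∈ Icc (0 : ℝ) 1, φ z = 0 ∨ Icc (0 : ℝ) 1 ∈ nhds z := by
    intro z hz
    rcases hz.1.eq_or_lt with h | h
    · left; rw [← h, hφ0]
    rcases hz.2.eq_or_lt with h' | h'
    · left; rw [h', hφ1]
    · exact Or.inr (Icc_mem_nhds h h')
  have hX : φ x * v' x = N * g * φ x := by
    rcases hend x hx with h | h
    · simp [h]
    have hloc : IsLocalMax (fun a => v a - v y - N * |a - y|) x := by
      filter_upwards [h] with a ha using hmax a ha y hy
    have := hloc.hasDerivAt_eq_zero (((hv x hx).sub_const (v y)).sub (hgx.const_mul N))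
    rw [sub_eq_zero.1 this]; ring
  have hY : φ y * v' y = N * g * φ y := by
    rcases hend y hy with h | h
    · simp [h]
    have hloc : IsLocalMax (fun a => v x - v a - N * |x - a|) y := by
      filter_upwards [h] with a ha using hmax x hx a ha
    have := hloc.hasDerivAt_eq_zero (((hv y hy).const_sub (v x)).sub (hgy.const_mul N))
    rw [show v' y = N * g by linarith]; ring
  rw [hX, hY, ← mul_sub]
  refine (abs_le.1 (?_ : |N * g * (φ x - φ y)| ≤ N * (m * |x - y|))).1
  rw [abs_mul, abs_mul, hg, mul_one, abs_of_nonneg hN]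
  gcongr

/-- A function continuous on `[0, T)` and integrable up to `T` has a bounded antiderivative. -/
theorem exists_bounded_antideriv {T : ℝ} (hT : 0 < T) {l : ℝ → ℝ}
    (hl : ContinuousOn l (Ico 0 T)) (hi : IntervalIntegrable l volume 0 T) :
    ∃ (L : ℝ → ℝ) (C : ℝ), L 0 = 0 ∧ ContinuousOn L (Ico 0 T) ∧
      (∀ s ∈ Ioo 0 T, HasDerivAt L (l s) s) ∧ ∀ t ∈ Ico 0 T, L t ≤ C := by
  have hc : ContinuousOn (fun t => ∫ s in (0 : ℝ)..t, l s) (Icc 0 T) := by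
    simpa [uIcc_of_le hT.le] using
      intervalIntegral.continuousOn_primitive_interval' hi (left_mem_uIcc)
  obtain ⟨C, hC⟩ := isCompact_Icc.exists_bound_of_continuousOn hc
  refine ⟨_, C, by simp, hc.mono Ico_subset_Icc_self, fun s hs => ?_,
    fun t ht => (le_abs_self _).trans (hC t (Ico_subset_Icc_self ht))⟩
  have hl' : ContinuousOn l (Ioo 0 T) := hl.mono Ioo_subset_Ico_self
  refine intervalIntegral.integral_hasDerivAt_right (hi.mono_set ?_)
    (hl'.stronglyMeasurableAtFilter isOpen_Ioo s hs) (hl'.continuousAt (isOpen_Ioo.mem_nhds hs))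
  rw [uIcc_of_le hs.1.le, uIcc_of_le hT.le]
  exact Icc_subset_Icc_right hs.2.le

/-- The supremum over `[0, 1]` of a jointly continuous function is continuous in the parameter. -/
theorem continuousOn_iSup_abs {u : ℝ → ℝ → ℝ} {S : Set ℝ}
    (hu : ContinuousOn (fun p : ℝ × ℝ => u p.1 p.2) (S ×ˢ Icc (0 : ℝ) 1)) :
    ContinuousOn (fun t => ⨆ x : Icc (0 : ℝ) 1, |u t x.1|) S := by
  rw [continuousOn_iff_continuous_domRestrict]
  let F : C(S × Icc (0 : ℝ) 1, ℝ) :=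
    ⟨fun p => u p.1.1 p.2.1, hu.comp_continuous
      (f := fun p : S × Icc (0 : ℝ) 1 => (p.1.1, p.2.1)) (by fun_prop) fun p => ⟨p.1.2, p.2.2⟩⟩
  convert F.curry.continuous.norm using 1
  ext t
  rw [ContinuousMap.norm_eq_iSup_norm]
  rfl

/-- A Lipschitz bound on `[0, 1]` bounds the derivative, including at the endpoints. -/
theorem abs_deriv_le_of_lipschitz_unit {v : ℝ → ℝ} {v' M x : ℝ} (hx : x ∈ Icc (0 : ℝ) 1)
    (hv : HasDerivAt v v' x) (hM : ∀ y ∈ Icc (0 : ℝ) 1, |v y - v x| ≤ M * |y - x|) :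
    |v'| ≤ M := by
  have ht := (hasDerivWithinAt_iff_tendsto_slope.1 (hv.hasDerivWithinAt (s := Icc (0 : ℝ) 1))).abs
  have hacc := uniqueDiffWithinAt_iff_accPt.1 (uniqueDiffOn_Icc_zero_one x hx)
  have : (nhdsWithin x (Icc (0 : ℝ) 1 \ {x})).NeBot := accPt_principal_iff_nhdsWithin.1 hacc
  refine le_of_tendsto ht ?_
  filter_upwards [self_mem_nhdsWithin] with y hy
  rw [slope_def_field, abs_div, div_le_iff₀ (abs_pos.2 (sub_ne_zero.2 hy.2))]
  exact hM y hy.1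

/-- A function transported by `f` and amplified at rate at most `m` grows at most like
`exp (∫ (m + 1))`. -/
theorem transported_le_exp {T N : ℝ} (hN : 0 ≤ N) {f fx r rt rx : ℝ → ℝ → ℝ} {m L : ℝ → ℝ}
    (hrt : ∀ t ∈ Ico (0 : ℝ) T, ∀ x ∈ Icc (0 : ℝ) 1, HasDerivAt (fun s => r s x) (rt t x) t)
    (hrx : ∀ t ∈ Ico (0 : ℝ) T, ∀ x ∈ Icc (0 : ℝ) 1, HasDerivAt (r t) (rx t x) x)
    (hcr : ContinuousOn (fun p : ℝ × ℝ => r p.1 p.2) (Ico (0 : ℝ) T ×ˢ Icc (0 : ℝ) 1))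
    (hpde : ∀ t ∈ Ico (0 : ℝ) T, ∀ x ∈ Icc (0 : ℝ) 1,
      rt t x + f t x * rx t x = r t x * fx t x)
    (hbc : ∀ t ∈ Ico (0 : ℝ) T, f t 0 = 0 ∧ f t 1 = 0)
    (hm : ∀ t ∈ Ico (0 : ℝ) T, ∀ x ∈ Icc (0 : ℝ) 1, |fx t x| ≤ m t)
    (hL0 : L 0 = 0) (hcL : ContinuousOn L (Ico 0 T))
    (hL : ∀ s ∈ Ioo 0 T, HasDerivAt L (m s + 1) s)
    (h0 : ∀ x ∈ Icc (0 : ℝ) 1, r 0 x ≤ N) :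
    ∀ t ∈ Ico (0 : ℝ) T, ∀ x ∈ Icc (0 : ℝ) 1, r t x ≤ N * Real.exp (L t) := by
  intro τ hτ x hx
  have hsub : Icc 0 τ ⊆ Ico 0 T := Icc_subset_Ico_right hτ.2
  have key := nonpos_of_deriv_neg_at_max (ι := Unit) (isCompact_Icc (a := (0 : ℝ)) (b := 1)) hτ.1
    (W := fun _ s z => Real.exp (-L s) * r s z - N) (fun _ => ?_) (fun _ z hz => ?_)
    (fun _ s hs z hz hpos hmax => ?_) () x hx
  · rw [sub_nonpos, Real.exp_neg, inv_mul_le_iff₀ (Real.exp_pos _)] at key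
    linarith
  · have hfst : ContinuousOn (fun p : ℝ × ℝ => L p.1) (Icc 0 τ ×ˢ Icc (0 : ℝ) 1) :=
      (hcL.mono hsub).comp continuousOn_fst fun p hp => hp.1
    exact (hfst.neg.rexp.mul (hcr.mono (prod_mono_left hsub))).sub continuousOn_const
  · simpa [hL0] using h0 z hz
  · have hsT := hsub ⟨hs.1.le, hs.2⟩
    have hE := Real.exp_pos (-L s)
    have hfr : f s z * rx s z = 0 := by
      rcases hz.1.eq_or_lt with h | h
      · rw [← h, (hbc s hsT).1, zero_mul]
      rcases hz.2.eq_or_lt with h' | h'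
      · rw [h', (hbc s hsT).2, zero_mul]
      have hloc : IsLocalMax (fun a => Real.exp (-L s) * r s a - N) z := by
        filter_upwards [Icc_mem_nhds h h'] with a ha using hmax () a ha
      have := hloc.hasDerivAt_eq_zero (((hrx s hsT z hz).const_mul _).sub_const _)
      rw [(mul_eq_zero.1 this).resolve_left hE.ne', mul_zero]
    have hder := (((hL s ⟨hs.1, hsT.2⟩).neg.exp).mul (hrt s hsT z hz)).sub_const N
    refine ⟨_, ?_, hder⟩
    have hp := hpde s hsT z hz
    rw [hfr, add_zero] at hp
    have hle := (abs_le.1 (hm s hsT z hz)).2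
    have hQ : 0 < Real.exp (-L s) * r s z := by linarith
    rw [hp, Pi.neg_apply]
    calc _ = Real.exp (-L s) * r s z * (fx s z - (m s + 1)) := by ring
      _ < 0 := mul_neg_of_pos_of_neg hQ (by linarith)

/-- Propagation of a common Lipschitz constant for finitely many functions transported by the same
velocity field, whose sources have oscillation controlled by the largest of their oscillations. -/
theorem lipschitz_propagation {ι : Type*} [Finite ι] {T N : ℝ} (hN : 0 ≤ N)
    {f : ℝ → ℝ → ℝ} {u ut ux G : ι → ℝ → ℝ → ℝ} {m c L : ℝ → ℝ}
    (hut : ∀ i, ∀ t ∈ Ico (0 : ℝ) T, ∀ x ∈ Icc (0 : ℝ) 1,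
      HasDerivAt (fun s => u i s x) (ut i t x) t)
    (hux : ∀ i, ∀ t ∈ Ico (0 : ℝ) T, ∀ x ∈ Icc (0 : ℝ) 1, HasDerivAt (u i t) (ux i t x) x)
    (hcu : ∀ i, ContinuousOn (fun p : ℝ × ℝ => u i p.1 p.2) (Ico (0 : ℝ) T ×ˢ Icc (0 : ℝ) 1))
    (hpde : ∀ i, ∀ t ∈ Ico (0 : ℝ) T, ∀ x ∈ Icc (0 : ℝ) 1,
      ut i t x + f t x * ux i t x = G i t x)
    (hbc : ∀ t ∈ Ico (0 : ℝ) T, f t 0 = 0 ∧ f t 1 = 0)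
    (hm : ∀ t ∈ Ico (0 : ℝ) T, 0 ≤ m t)
    (hf : ∀ t ∈ Ico (0 : ℝ) T, ∀ x ∈ Icc (0 : ℝ) 1, ∀ y ∈ Icc (0 : ℝ) 1,
      |f t x - f t y| ≤ m t * |x - y|)
    (hG : ∀ i, ∀ t ∈ Ico (0 : ℝ) T, ∀ x ∈ Icc (0 : ℝ) 1, ∀ y ∈ Icc (0 : ℝ) 1, ∀ D,
      (∀ j, |u j t x - u j t y| ≤ D) → G i t x - G i t y ≤ c t * D)
    (hL0 : L 0 = 0) (hcL : ContinuousOn L (Ico 0 T))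
    (hL : ∀ s ∈ Ioo 0 T, HasDerivAt L (m s + c s + 1) s)
    (h0 : ∀ i, ∀ x ∈ Icc (0 : ℝ) 1, ∀ y ∈ Icc (0 : ℝ) 1, u i 0 x - u i 0 y ≤ N * |x - y|) :
    ∀ i, ∀ t ∈ Ico (0 : ℝ) T, ∀ x ∈ Icc (0 : ℝ) 1, ∀ y ∈ Icc (0 : ℝ) 1,
      |u i t x - u i t y| ≤ N * Real.exp (L t) * |x - y| := by
  suffices H : ∀ i, ∀ t ∈ Ico (0 : ℝ) T, ∀ x ∈ Icc (0 : ℝ) 1, ∀ y ∈ Icc (0 : ℝ) 1,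
      u i t x - u i t y ≤ N * Real.exp (L t) * |x - y| from fun i t ht x hx y hy =>
    abs_sub_le_iff.2 ⟨H i t ht x hx y hy, abs_sub_comm x y ▸ H i t ht y hy x hx⟩
  intro i τ hτ x hx y hy
  have hsub : Icc 0 τ ⊆ Ico 0 T := Icc_subset_Ico_right hτ.2
  have key := nonpos_of_deriv_neg_at_max
    ((isCompact_Icc (a := (0 : ℝ)) (b := 1)).prod (isCompact_Icc (a := (0 : ℝ)) (b := 1))) hτ.1
    (W := fun j s z => Real.exp (-L s) * (u j s z.1 - u j s z.2) - N * |z.1 - z.2|)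
    (fun j => ?_) (fun j z hz => ?_) (fun j s hs z hz hpos hmax => ?_) i (x, y) ⟨hx, hy⟩
  · rw [sub_nonpos, Real.exp_neg, inv_mul_le_iff₀ (Real.exp_pos _)] at key
    linarith
  · have hfst : ContinuousOn (fun p : ℝ × ℝ × ℝ => L p.1)
        (Icc 0 τ ×ˢ (Icc (0 : ℝ) 1 ×ˢ Icc (0 : ℝ) 1)) :=
      (hcL.mono hsub).comp continuousOn_fst fun p hp => hp.1
    have hu1 : ContinuousOn (fun p : ℝ × ℝ × ℝ => u j p.1 p.2.1)
        (Icc 0 τ ×ˢ (Icc (0 : ℝ) 1 ×ˢ Icc (0 : ℝ) 1)) :=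
      (hcu j).comp (f := fun p : ℝ × ℝ × ℝ => (p.1, p.2.1)) (by fun_prop)
        fun p hp => ⟨hsub hp.1, hp.2.1⟩
    have hu2 : ContinuousOn (fun p : ℝ × ℝ × ℝ => u j p.1 p.2.2)
        (Icc 0 τ ×ˢ (Icc (0 : ℝ) 1 ×ˢ Icc (0 : ℝ) 1)) :=
      (hcu j).comp (f := fun p : ℝ × ℝ × ℝ => (p.1, p.2.2)) (by fun_prop)
        fun p hp => ⟨hsub hp.1, hp.2.2⟩
    exact (hfst.neg.rexp.mul (hu1.sub hu2)).sub (by fun_prop)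
  · simpa [hL0] using h0 j z.1 hz.1 z.2 hz.2
  · obtain ⟨a, b⟩ := z
    obtain ⟨ha, hb⟩ : a ∈ Icc (0 : ℝ) 1 ∧ b ∈ Icc (0 : ℝ) 1 := hz
    simp only at hpos hmax
    have hsT := hsub ⟨hs.1.le, hs.2⟩
    have hab : a ≠ b := by
      rintro rfl
      simp at hpos
    have hE := Real.exp_pos (-L s)
    have htr := transport_lower_bound_at_max (v := fun x => Real.exp (-L s) * u j s x) hN
      (fun x hx => (hux j s hsT x hx).const_mul _) (hbc s hsT).1 (hbc s hsT).2
      (hf s hsT a ha b hb) ha hb hab fun x' hx' y' hy' => by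
        have := hmax j (x', y') ⟨hx', hy'⟩
        simp only at this
        linarith
    have hder := (((hL s ⟨hs.1, hsT.2⟩).neg.exp).mul
      ((hut j s hsT a ha).sub (hut j s hsT b hb))).sub_const (N * |a - b|)
    refine ⟨_, ?_, hder⟩
    set E := Real.exp (-L s) with hEdef
    set Q := E * (u j s a - u j s b) with hQdef
    have hNd : 0 ≤ N * |a - b| := by positivity
    have hosc : ∀ k, |u k s a - u k s b| ≤ Q / E := fun k => by
      have h1 := hmax k (a, b) ⟨ha, hb⟩
      have h2 := hmax k (b, a) ⟨hb, ha⟩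
      simp only [abs_sub_comm b a] at h1 h2
      rw [abs_sub_le_iff, le_div_iff₀ hE, le_div_iff₀ hE]
      constructor <;> linarith
    have hGd := hG j s hsT a ha b hb _ hosc
    have hGE : E * (G j s a - G j s b) ≤ c s * Q := by
      calc _ ≤ E * (c s * (Q / E)) := by gcongr
        _ = c s * Q := by field_simp
    have hmN : N * (m s * |a - b|) ≤ m s * Q := by
      calc _ = m s * (N * |a - b|) := by ring
        _ ≤ m s * Q := mul_le_mul_of_nonneg_left (by linarith) (hm s hsT)
    have hpa := hpde j s hsT a ha
    have hpb := hpde j s hsT b hb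
    have hQ : 0 < Q := by linarith
    rw [show ut j s a = G j s a - f s a * ux j s a by linarith,
      show ut j s b = G j s b - f s b * ux j s b by linarith]
    simp only [Pi.sub_apply, Pi.neg_apply, ← hEdef]
    calc _ = E * (G j s a - G j s b) - (f s a * (E * ux j s a) - f s b * (E * ux j s b))
          - m s * Q - c s * Q - Q := by rw [hQdef]; ring
      _ < 0 := by linarith

/-- (A priori estimate behind the regularity criterion, Theorem 2.1.)
Let `(f, ρ)` be a classical solution of the reduced Boussinesq system
`f_{xt} + f f_{xx} - f_x² + ρ = I(t)`, `ρ_t + f ρ_x = ρ f_x` on `[0,T*) × [0,1]`,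
with `I(t) = ∫₀¹ ρ dx - 2∫₀¹ f_x² dx` and Dirichlet boundary conditions.
If `∫₀^{T*} ‖f_x(t,·)‖_{L^∞([0,1])} dt < ∞`, then
`‖f_x(t,·)‖_{L^∞} + ∫₀¹ (ρ² + ρ_x² + f_x² + f_{xx}²) dx` is uniformly bounded on `[0,T*)`. -/
theorem stmt5 (T : ℝ) (hT : 0 < T)
    (f ρ fx fxx fxxx fxt ρt ρx : ℝ → ℝ → ℝ)
    (hfx : ∀ t ∈ Ico (0:ℝ) T, ∀ x ∈ Icc (0:ℝ) 1, HasDerivAt (f t) (fx t x) x)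
    (hfxx : ∀ t ∈ Ico (0:ℝ) T, ∀ x ∈ Icc (0:ℝ) 1, HasDerivAt (fx t) (fxx t x) x)
    (hfxxx : ∀ t ∈ Ico (0:ℝ) T, ∀ x ∈ Icc (0:ℝ) 1, HasDerivAt (fxx t) (fxxx t x) x)
    (hfxt : ∀ t ∈ Ico (0:ℝ) T, ∀ x ∈ Icc (0:ℝ) 1, HasDerivAt (fun s => fx s x) (fxt t x) t)
    (hρt : ∀ t ∈ Ico (0:ℝ) T, ∀ x ∈ Icc (0:ℝ) 1, HasDerivAt (fun s => ρ s x) (ρt t x) t)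
    (hρx : ∀ t ∈ Ico (0:ℝ) T, ∀ x ∈ Icc (0:ℝ) 1, HasDerivAt (ρ t) (ρx t x) x)
    (hcf : ContinuousOn (fun p : ℝ × ℝ => f p.1 p.2) (Ico (0:ℝ) T ×ˢ Icc (0:ℝ) 1))
    (hcρ : ContinuousOn (fun p : ℝ × ℝ => ρ p.1 p.2) (Ico (0:ℝ) T ×ˢ Icc (0:ℝ) 1))
    (hcfx : ContinuousOn (fun p : ℝ × ℝ => fx p.1 p.2) (Ico (0:ℝ) T ×ˢ Icc (0:ℝ) 1))
    (hcfxx : ContinuousOn (fun p : ℝ × ℝ => fxx p.1 p.2) (Ico (0:ℝ) T ×ˢ Icc (0:ℝ) 1))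
    (hcfxxx : ContinuousOn (fun p : ℝ × ℝ => fxxx p.1 p.2) (Ico (0:ℝ) T ×ˢ Icc (0:ℝ) 1))
    (hcfxt : ContinuousOn (fun p : ℝ × ℝ => fxt p.1 p.2) (Ico (0:ℝ) T ×ˢ Icc (0:ℝ) 1))
    (hcρt : ContinuousOn (fun p : ℝ × ℝ => ρt p.1 p.2) (Ico (0:ℝ) T ×ˢ Icc (0:ℝ) 1))
    (hcρx : ContinuousOn (fun p : ℝ × ℝ => ρx p.1 p.2) (Ico (0:ℝ) T ×ˢ Icc (0:ℝ) 1))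
    (hpde1 : ∀ t ∈ Ico (0:ℝ) T, ∀ x ∈ Icc (0:ℝ) 1,
      fxt t x + f t x * fxx t x - (fx t x) ^ 2 + ρ t x
        = (∫ y in (0:ℝ)..1, ρ t y) - 2 * ∫ y in (0:ℝ)..1, (fx t y) ^ 2)
    (hpde2 : ∀ t ∈ Ico (0:ℝ) T, ∀ x ∈ Icc (0:ℝ) 1,
      ρt t x + f t x * ρx t x = ρ t x * fx t x)
    (hbcf : ∀ t ∈ Ico (0:ℝ) T, f t 0 = 0 ∧ f t 1 = 0)
    (hbcρ : ∀ t ∈ Ico (0:ℝ) T, ρ t 0 = 0 ∧ ρ t 1 = 0)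
    (hint : IntervalIntegrable (fun t => ⨆ x : Icc (0:ℝ) 1, |fx t x.1|)
      MeasureTheory.volume 0 T) :
    ∃ M : ℝ, ∀ t ∈ Ico (0:ℝ) T,
      (⨆ x : Icc (0:ℝ) 1, |fx t x.1|) +
        (∫ x in (0:ℝ)..1,
          ((ρ t x) ^ 2 + (ρx t x) ^ 2 + (fx t x) ^ 2 + (fxx t x) ^ 2)) ≤ M := by
  have hI : ∀ {t : ℝ}, t ∈ Ico (0 : ℝ) T → ∀ {u : ℝ → ℝ → ℝ},
      ContinuousOn (fun p : ℝ × ℝ => u p.1 p.2) (Ico (0 : ℝ) T ×ˢ Icc (0 : ℝ) 1) →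
      ContinuousOn (u t) (Icc 0 1) := fun {t} ht u hu =>
    hu.comp (f := fun x : ℝ => (t, x)) (by fun_prop) fun x hx => ⟨ht, hx⟩
  have hT0 : (0 : ℝ) ∈ Ico 0 T := ⟨le_rfl, hT⟩
  have hI0 : (0 : ℝ) ∈ Icc (0 : ℝ) 1 := by simp
  have hlip : ∀ {v v' : ℝ → ℝ} {C : ℝ}, (∀ x ∈ Icc (0 : ℝ) 1, HasDerivAt v (v' x) x) →
      (∀ x ∈ Icc (0 : ℝ) 1, |v' x| ≤ C) → ∀ x ∈ Icc (0 : ℝ) 1, ∀ y ∈ Icc (0 : ℝ) 1,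
      |v x - v y| ≤ C * |x - y| := fun hv hC x hx y hy =>
    (convex_Icc (0 : ℝ) 1).norm_image_sub_le_of_norm_hasDerivWithin_le
      (fun z hz => (hv z hz).hasDerivWithinAt) hC hy hx
  set m : ℝ → ℝ := fun t => ⨆ x : Icc (0:ℝ) 1, |fx t x.1|
  have hmc : ContinuousOn m (Ico 0 T) := continuousOn_iSup_abs hcfx
  have hm : ∀ t ∈ Ico (0 : ℝ) T, ∀ x ∈ Icc (0 : ℝ) 1, |fx t x| ≤ m t := by
    intro t ht x hx
    obtain ⟨C, hC⟩ := isCompact_Icc.exists_bound_of_continuousOn (hI ht hcfx)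
    exact le_ciSup (f := fun x : Icc (0 : ℝ) 1 => |fx t x.1|)
      ⟨C, by rintro _ ⟨y, rfl⟩; exact hC y y.2⟩ ⟨x, hx⟩
  have hm0 : ∀ t ∈ Ico (0 : ℝ) T, 0 ≤ m t := fun t ht =>
    (abs_nonneg _).trans (hm t ht 0 hI0)
  -- the sup norm of `ρ`
  obtain ⟨R, hR⟩ : ∃ R, ∀ t ∈ Ico (0 : ℝ) T, ∀ x ∈ Icc (0 : ℝ) 1, |ρ t x| ≤ R := by
    obtain ⟨L, C, hL0, hcL, hL, hLC⟩ := exists_bounded_antideriv hT (l := fun t => m t + 1)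
      (hmc.add continuousOn_const) (hint.add intervalIntegrable_const)
    obtain ⟨N, hN⟩ := isCompact_Icc.exists_bound_of_continuousOn (hI hT0 hcρ)
    have hN0 : 0 ≤ N := (norm_nonneg _).trans (hN 0 hI0)
    refine ⟨N * Real.exp C, fun t ht x hx => ?_⟩
    have hexp : N * Real.exp (L t) ≤ N * Real.exp C := by
      gcongr
      exact hLC t ht
    refine abs_le'.2 ⟨?_, ?_⟩
    · exact (transported_le_exp hN0 hρt hρx hcρ hpde2 hbcf hm hL0 hcL hL
        (fun x hx => (le_abs_self _).trans (hN x hx)) t ht x hx).trans hexp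
    · refine (transported_le_exp (r := fun t x => -ρ t x) (rt := fun t x => -ρt t x)
        (rx := fun t x => -ρx t x) hN0 (fun t ht x hx => (hρt t ht x hx).neg)
        (fun t ht x hx => (hρx t ht x hx).neg) hcρ.neg (fun t ht x hx => ?_) hbcf hm hL0 hcL hL
        (fun x hx => (neg_le_abs _).trans (hN x hx)) t ht x hx).trans hexp
      linarith [hpde2 t ht x hx]
  -- a common Lipschitz constant for `fx` and `ρ`
  obtain ⟨M, hMf, hMρ⟩ : ∃ M, (∀ t ∈ Ico (0 : ℝ) T, ∀ x ∈ Icc (0 : ℝ) 1, ∀ y ∈ Icc (0 : ℝ) 1,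
      |fx t x - fx t y| ≤ M * |x - y|) ∧ ∀ t ∈ Ico (0 : ℝ) T, ∀ x ∈ Icc (0 : ℝ) 1,
      ∀ y ∈ Icc (0 : ℝ) 1, |ρ t x - ρ t y| ≤ M * |x - y| := by
    obtain ⟨L, C, hL0, hcL, hL, hLC⟩ := exists_bounded_antideriv hT
      (l := fun t => m t + (2 * m t + R + 1) + 1) (by fun_prop)
      ((hint.add (((hint.const_mul 2).add intervalIntegrable_const).add
        intervalIntegrable_const)).add intervalIntegrable_const)
    obtain ⟨N₁, hN₁⟩ := isCompact_Icc.exists_bound_of_continuousOn (hI hT0 hcfxx)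
    obtain ⟨N₂, hN₂⟩ := isCompact_Icc.exists_bound_of_continuousOn (hI hT0 hcρx)
    set N := max N₁ N₂
    have hN0 : 0 ≤ N := (norm_nonneg _).trans ((hN₁ 0 hI0).trans (le_max_left _ _))
    have key := lipschitz_propagation (ι := Bool) (T := T) (N := N) hN0 (f := f)
      (u := fun i => cond i fx ρ) (ut := fun i => cond i fxt ρt) (ux := fun i => cond i fxx ρx)
      (G := fun i => cond i (fun t x => fx t x ^ 2 - ρ t x +
          ((∫ y in (0:ℝ)..1, ρ t y) - 2 * ∫ y in (0:ℝ)..1, (fx t y) ^ 2))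
        (fun t x => ρ t x * fx t x))
      (m := m) (c := fun t => 2 * m t + R + 1) (L := L)
      (by rintro (_ | _); exacts [hρt, hfxt]) (by rintro (_ | _); exacts [hρx, hfxx])
      (by rintro (_ | _); exacts [hcρ, hcfx])
      (by
        rintro (_ | _) t ht x hx
        · exact hpde2 t ht x hx
        · simp only [cond_true]
          linarith [hpde1 t ht x hx])
      hbcf hm0 (fun t ht => hlip (hfx t ht) (hm t ht)) ?_ hL0 hcL hL
      (by
        rintro (_ | _) x hx y hy
        · exact (le_abs_self _).trans (hlip (hρx 0 hT0)
            (fun z hz => (hN₂ z hz).trans (le_max_right _ _)) x hx y hy)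
        · exact (le_abs_self _).trans (hlip (hfxx 0 hT0)
            (fun z hz => (hN₁ z hz).trans (le_max_left _ _)) x hx y hy))
    · have hexp : ∀ t ∈ Ico (0 : ℝ) T, ∀ d : ℝ,
          N * Real.exp (L t) * |d| ≤ N * Real.exp C * |d| := fun t ht d => by
        gcongr
        exact hLC t ht
      exact ⟨N * Real.exp C,
        fun t ht x hx y hy => (key true t ht x hx y hy).trans (hexp t ht _),
        fun t ht x hx y hy => (key false t ht x hx y hy).trans (hexp t ht _)⟩
    · rintro i t ht x hx y hy D hD
      have h1 : |fx t x - fx t y| ≤ D := hD true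
      have h2 : |ρ t x - ρ t y| ≤ D := hD false
      have hD0 : 0 ≤ D := (abs_nonneg _).trans h1
      have hbound : ∀ {a b k : ℝ}, |a| ≤ k → |b| ≤ D → a * b ≤ k * D := fun {a b k} ha hb =>
        (le_abs_self _).trans <| by
          rw [abs_mul]
          exact mul_le_mul ha hb (abs_nonneg _) ((abs_nonneg _).trans ha)
      have hx1 := hbound (hm t ht x hx) h1
      have hy1 := hbound (hm t ht y hy) h1
      have hx2 := hbound (hm t ht x hx) h2
      have hy2 := hbound (hR t ht y hy) h1
      have hmD := mul_nonneg (hm0 t ht) hD0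
      have hRD := mul_nonneg ((abs_nonneg _).trans (hR t ht y hy)) hD0
      cases i
      · simp only [cond_false]
        linarith
      · simp only [cond_true]
        linarith [(abs_le.1 h2).1]
  have hfxM : ∀ t ∈ Ico (0 : ℝ) T, ∀ x ∈ Icc (0 : ℝ) 1, |fx t x| ≤ M := by
    intro t ht x hx
    obtain ⟨z, hz, hz0⟩ := exists_hasDerivAt_eq_zero (f := f t) (f' := fx t) zero_lt_one
      (hI ht hcf) (by rw [(hbcf t ht).1, (hbcf t ht).2])
      fun y hy => hfx t ht y (Ioo_subset_Icc_self hy)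
    have hM0 : 0 ≤ M := by simpa using (abs_nonneg _).trans (hMf t ht 0 hI0 1 (by simp))
    have := hMf t ht x hx z (Ioo_subset_Icc_self hz)
    rw [hz0, sub_zero] at this
    refine this.trans (mul_le_of_le_one_right hM0 (abs_le.2 ⟨?_, ?_⟩)) <;>
      linarith [hx.1, hx.2, hz.1, hz.2]
  refine ⟨M + (R ^ 2 + M ^ 2 + M ^ 2 + M ^ 2), fun t ht => add_le_add ?_ ?_⟩
  · exact ciSup_le fun x => hfxM t ht x x.2
  · refine (le_abs_self _).trans ?_
    have := intervalIntegral.norm_integral_le_of_norm_le_const (a := (0 : ℝ)) (b := 1)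
      (C := R ^ 2 + M ^ 2 + M ^ 2 + M ^ 2)
      (f := fun x => ρ t x ^ 2 + ρx t x ^ 2 + fx t x ^ 2 + fxx t x ^ 2) fun x hx => ?_
    · simpa using this
    · rw [uIoc_of_le zero_le_one] at hx
      have hx' := Ioc_subset_Icc_self hx
      rw [Real.norm_of_nonneg (by positivity)]
      have hρxM := abs_deriv_le_of_lipschitz_unit hx' (hρx t ht x hx')
        fun y hy => hMρ t ht y hy x hx'
      have hfxxM := abs_deriv_le_of_lipschitz_unit hx' (hfxx t ht x hx')
        fun y hy => hMf t ht y hy x hx'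
      exact add_le_add (add_le_add (add_le_add (sq_le_sq.2 ((hR t ht x hx').trans (le_abs_self _)))
        (sq_le_sq.2 (hρxM.trans (le_abs_self _))))
        (sq_le_sq.2 ((hfxM t ht x hx').trans (le_abs_self _))))
        (sq_le_sq.2 (hfxxM.trans (le_abs_self _)))
end

section
/- Let f₀ : [0,1] → ℝ be continuously differentiable with M₀ := max_{x∈[0,1]} f₀'(x) > 0, let ρ₀ : [0,1] → ℝ be continuous with ρ₀(x) ≥ 0 for all x, and set η* = 1/M₀. Let T ∈ (0,∞] and let φ₁, η : [0,T) → ℝ be continuous with φ₁(0) = 1, φ₁(t) ≠ 0 for all t, η differentiable with η'(t) = φ₁(t)^{-2} and η(0) = 0, and suppose 0 ≤ η(t) < η* for all t ∈ [0,T). Define g(t) = ∫₀ᵗ η(s) φ₁(s) ds - η(t) ∫₀ᵗ φ₁(s) ds and suppose φ₁ satisfies the relation φ₁(t) = ∫₀¹ (1 - η(t) f₀'(x) - ρ₀(x) g(t))^{-1} dx for all t ∈ [0,T). Then: (i) φ₁(t) > 0 for all t ∈ [0,T); (ii) g(t) ≤ 0 for all t ∈ [0,T); (iii) 1 - η(t)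 f₀'(x) - ρ₀(x) g(t) ≥ 1 - η(t) f₀'(x) > 0 for all t ∈ [0,T) and x ∈ [0,1]; (iv) 0 < φ₁(t) ≤ ∫₀¹ (1 - η(t) f₀'(x))^{-1} dx for all t ∈ [0,T). -/
open Set MeasureTheory
open scoped ENNReal

/-- (Lemma 3.1 together with (3.20)–(3.21).) Here the time interval
`[0,T)` with `T ∈ (0,∞]` is encoded as `{t : ℝ | 0 ≤ t ∧ ENNReal.ofReal t < T}` for
`T : ℝ≥0∞`.  Under the conservation-of-mean relation for `φ₁` and `0 ≤ η < η* = 1/M₀`,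
one has `φ₁ > 0`, `g ≤ 0`, `1 - η f₀' - ρ₀ g ≥ 1 - η f₀' > 0`, and
`0 < φ₁(t) ≤ ∫₀¹ (1 - η(t) f₀'(x))⁻¹ dx`. -/
theorem stmt10 (f₀ f₀d : ℝ → ℝ)
    (hf₀d : ∀ x ∈ Icc (0:ℝ) 1, HasDerivAt f₀ (f₀d x) x)
    (hf₀dc : ContinuousOn f₀d (Icc (0:ℝ) 1))
    (M₀ : ℝ) (hM₀pos : 0 < M₀)
    (hub : ∀ x ∈ Icc (0:ℝ) 1, f₀d x ≤ M₀)
    (hatt : ∃ x ∈ Icc (0:ℝ) 1, f₀d x = M₀)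
    (ρ₀ : ℝ → ℝ) (hρ₀c : ContinuousOn ρ₀ (Icc (0:ℝ) 1))
    (hρ₀ : ∀ x ∈ Icc (0:ℝ) 1, 0 ≤ ρ₀ x)
    (T : ℝ≥0∞) (hT : 0 < T)
    (φ₁ η : ℝ → ℝ)
    (hφ₁c : ContinuousOn φ₁ {t : ℝ | 0 ≤ t ∧ ENNReal.ofReal t < T})
    (hφ₁0 : φ₁ 0 = 1)
    (hφ₁ne : ∀ t, 0 ≤ t → ENNReal.ofReal t < T → φ₁ t ≠ 0)
    (hη : ∀ t, 0 ≤ t → ENNReal.ofReal t < T → HasDerivAt η ((φ₁ t ^ 2)⁻¹) t)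
    (hη0 : η 0 = 0)
    (hηrange : ∀ t, 0 ≤ t → ENNReal.ofReal t < T → 0 ≤ η t ∧ η t < 1 / M₀)
    (g : ℝ → ℝ)
    (hg : ∀ t : ℝ, g t = (∫ s in (0:ℝ)..t, η s * φ₁ s) - η t * ∫ s in (0:ℝ)..t, φ₁ s)
    (hrel : ∀ t, 0 ≤ t → ENNReal.ofReal t < T →
      φ₁ t = ∫ x in (0:ℝ)..1, (1 - η t * f₀d x - ρ₀ x * g t)⁻¹) :
    ∀ t, 0 ≤ t → ENNReal.ofReal t < T →
      0 < φ₁ t ∧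
      g t ≤ 0 ∧
      (∀ x ∈ Icc (0:ℝ) 1,
        1 - η t * f₀d x ≤ 1 - η t * f₀d x - ρ₀ x * g t ∧ 0 < 1 - η t * f₀d x) ∧
      φ₁ t ≤ ∫ x in (0:ℝ)..1, (1 - η t * f₀d x)⁻¹ := by
  intro t ht htT
  have hsub : ∀ s ∈ Icc (0:ℝ) t, 0 ≤ s ∧ ENNReal.ofReal s < T := fun s hs =>
    ⟨hs.1, (ENNReal.ofReal_le_ofReal hs.2).trans_lt htT⟩
  have hφc : ContinuousOn φ₁ (Icc 0 t) := hφ₁c.mono hsub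
  have hφpos : ∀ s ∈ Icc (0:ℝ) t, 0 < φ₁ s := by
    intro s hs
    by_contra! h
    obtain ⟨r, hr, hr0⟩ := intermediate_value_Icc' hs.1
      (hφc.mono (Icc_subset_Icc_right hs.2)) (show (0:ℝ) ∈ Icc (φ₁ s) (φ₁ 0) by simp [h, hφ₁0])
    have hrT := hsub r ⟨hr.1, hr.2.trans hs.2⟩
    exact hφ₁ne r hrT.1 hrT.2 hr0
  have hηd : ∀ s ∈ Icc (0:ℝ) t, HasDerivAt η ((φ₁ s ^ 2)⁻¹) s := fun s hs =>
    hη s (hsub s hs).1 (hsub s hs).2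
  have hηc : ContinuousOn η (Icc 0 t) := fun s hs => (hηd s hs).continuousAt.continuousWithinAt
  have hηmono : MonotoneOn η (Icc 0 t) := by
    refine monotoneOn_of_hasDerivWithinAt_nonneg (convex_Icc 0 t) hηc
      (fun s hs => (hηd s (interior_subset hs)).hasDerivWithinAt) fun s _ => ?_
    positivity
  have hgt : g t ≤ 0 := by
    have hle : ∫ s in (0:ℝ)..t, η s * φ₁ s ≤ ∫ s in (0:ℝ)..t, η t * φ₁ s := by
      refine intervalIntegral.integral_mono_on ht
        ((hηc.mul hφc).intervalIntegrable_of_Icc ht)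
        ((continuousOn_const.mul hφc).intervalIntegrable_of_Icc ht) fun s hs => ?_
      exact mul_le_mul_of_nonneg_right (hηmono hs (right_mem_Icc.2 ht) hs.2) (hφpos s hs).le
    rw [intervalIntegral.integral_const_mul] at hle
    rw [hg t]
    linarith
  obtain ⟨hη₀, hη₁⟩ := hηrange t ht htT
  have hpos : ∀ x ∈ Icc (0:ℝ) 1, 0 < 1 - η t * f₀d x := by
    intro x hx
    have h₁ := mul_le_mul_of_nonneg_left (hub x hx) hη₀
    have h₂ := (lt_div_iff₀ hM₀pos).1 hη₁
    linarith
  have hle : ∀ x ∈ Icc (0:ℝ) 1, 1 - η t * f₀d x ≤ 1 - η t * f₀d x - ρ₀ x * g t := by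
    intro x hx
    have := mul_nonpos_of_nonneg_of_nonpos (hρ₀ x hx) hgt
    linarith
  refine ⟨hφpos t (right_mem_Icc.2 ht), hgt, fun x hx => ⟨hle x hx, hpos x hx⟩, ?_⟩
  have hc : ContinuousOn (fun x => 1 - η t * f₀d x) (Icc 0 1) :=
    continuousOn_const.sub (continuousOn_const.mul hf₀dc)
  rw [hrel t ht htT]
  refine intervalIntegral.integral_mono_on zero_le_one ?_ ?_ fun x hx =>
    inv_anti₀ (hpos x hx) (hle x hx)
  · exact ((hc.sub (hρ₀c.mul continuousOn_const)).inv₀ fun x hx =>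
      ((hpos x hx).trans_le (hle x hx)).ne').intervalIntegrable_of_Icc zero_le_one
  · exact (hc.inv₀ fun x hx => (hpos x hx).ne').intervalIntegrable_of_Icc zero_le_one
end

section
/- Let f₀ : [0,1] → ℝ be twice continuously differentiable such that M₀ := max_{x∈[0,1]} f₀'(x) > 0 is attained only at x = 0 and f₀''(0) < 0, and set η* = 1/M₀. Then lim_{η → η*⁻} [ ∫₀¹ (1 - η f₀'(x))^{-1} dx ] / ( -ln(η* - η) ) = M₀ / |f₀''(0)|. -/
open Set MeasureTheory Filter

/-- If `p ≤ q` near `0` and `p < M` on `(0,1]`, then, as `η → (1/M)⁻`, the integral of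
`(1 - η p)⁻¹` exceeds that of `(1 - η q)⁻¹` by at most a constant. -/
theorem exists_integral_inv_one_sub_mul_le_add {p q : ℝ → ℝ} {M : ℝ} (hM : 0 < M)
    (hp : ContinuousOn p (Icc 0 1)) (hq : ContinuousOn q (Icc 0 1))
    (hpM : ∀ x ∈ Icc (0:ℝ) 1, p x ≤ M) (hqM : ∀ x ∈ Icc (0:ℝ) 1, q x ≤ M)
    (hlt : ∀ x ∈ Ioc (0:ℝ) 1, p x < M)
    (hpq : ∀ᶠ x in nhdsWithin (0:ℝ) (Ici 0), p x ≤ q x) :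
    ∃ C : ℝ, ∀ᶠ η in nhdsWithin (1 / M) (Iio (1 / M)),
      ∫ x in (0:ℝ)..1, (1 - η * p x)⁻¹ ≤ (∫ x in (0:ℝ)..1, (1 - η * q x)⁻¹) + C := by
  obtain ⟨r, hr, hrpq⟩ := (mem_nhdsGE_iff_exists_Ico_subset).1 hpq
  have hr : 0 < r := hr
  obtain ⟨m, hm, hpm⟩ : ∃ m > 0, ∀ x ∈ Icc r 1, p x ≤ M - m := by
    rcases (Icc r (1:ℝ)).eq_empty_or_nonempty with he | hne
    · exact ⟨1, one_pos, by simp [he]⟩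
    · obtain ⟨y, hy, hmax⟩ := isCompact_Icc.exists_isMaxOn hne
        (hp.mono (Icc_subset_Icc_left hr.le))
      refine ⟨M - p y, sub_pos.2 (hlt y ⟨hr.trans_le hy.1, hy.2⟩), fun x hx => ?_⟩
      have : p x ≤ p y := hmax hx
      linarith
  refine ⟨2 * M / m, ?_⟩
  have hhalf : 1 / (2 * M) < 1 / M := one_div_lt_one_div_of_lt hM (by linarith)
  filter_upwards [Ioo_mem_nhdsLT hhalf] with η hη
  have hη0 : 0 < η := lt_trans (by positivity) hη.1
  have hηM : η * M < 1 := (lt_div_iff₀ hM).1 hη.2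
  have hηm : m / (2 * M) ≤ η * m := by
    have := mul_le_mul_of_nonneg_right hη.1.le hm.le
    calc m / (2 * M) = 1 / (2 * M) * m := by ring
      _ ≤ _ := this
  have pos_of_le {y : ℝ} (hy : y ≤ M) : 0 < 1 - η * y := by
    have := mul_le_mul_of_nonneg_left hy hη0.le
    linarith
  have hint {g : ℝ → ℝ} (hg : ContinuousOn g (Icc 0 1)) (hgM : ∀ x ∈ Icc (0:ℝ) 1, g x ≤ M) :
      IntervalIntegrable (fun x => (1 - η * g x)⁻¹) volume 0 1 := by
    refine ContinuousOn.intervalIntegrable_of_Icc zero_le_one ?_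
    exact (continuousOn_const.sub (continuousOn_const.mul hg)).inv₀
      fun x hx => (pos_of_le (hgM x hx)).ne'
  calc ∫ x in (0:ℝ)..1, (1 - η * p x)⁻¹
      ≤ ∫ x in (0:ℝ)..1, ((1 - η * q x)⁻¹ + 2 * M / m) := by
        refine intervalIntegral.integral_mono_on zero_le_one (hint hp hpM)
          ((hint hq hqM).add intervalIntegrable_const) fun x hx => ?_
        have hqx := pos_of_le (hqM x hx)
        rcases lt_or_ge x r with hxr | hxr
        · have hle : p x ≤ q x := hrpq ⟨hx.1, hxr⟩
          have : (1 - η * p x)⁻¹ ≤ (1 - η * q x)⁻¹ := by gcongr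
          have : 0 ≤ 2 * M / m := by positivity
          linarith
        · have hpx : m / (2 * M) ≤ 1 - η * p x := by
            have := mul_le_mul_of_nonneg_left (hpm x ⟨hxr, hx.2⟩) hη0.le
            linarith
          have : (1 - η * p x)⁻¹ ≤ 2 * M / m := by
            rw [← inv_div]
            gcongr
          have := inv_pos.2 hqx
          linarith
    _ = _ := by
        rw [intervalIntegral.integral_add (hint hq hqM) intervalIntegrable_const]
        simp

/-- The logarithmic asymptotics for the linear profile `M - k x`, up to a constant. -/
theorem tendsto_integral_inv_linear_add_div_log {M k : ℝ} (hM : 0 < M) (hk : 0 < k) (C : ℝ) :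
    Tendsto
      (fun η : ℝ =>
        ((∫ x in (0:ℝ)..1, (1 - η * (M - k * x))⁻¹) + C) / (-Real.log (1 / M - η)))
      (nhdsWithin (1 / M) (Iio (1 / M))) (nhds (M / k)) := by
  have hid : Tendsto (fun η : ℝ => η) (nhdsWithin (1 / M) (Iio (1 / M))) (nhds (1 / M)) :=
    tendsto_id.mono_left nhdsWithin_le_nhds
  have hlog : Tendsto (fun η : ℝ => -Real.log (1 / M - η))
      (nhdsWithin (1 / M) (Iio (1 / M))) atTop := by
    refine tendsto_neg_atBot_atTop.comp (Real.tendsto_log_nhdsGT_zero.comp ?_)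
    refine tendsto_nhdsWithin_iff.2 ⟨?_, ?_⟩
    · simpa using (tendsto_const_nhds (x := 1 / M)).sub hid
    · filter_upwards [self_mem_nhdsWithin] with η hη using sub_pos.2 (mem_Iio.1 hη)
  have hinv := tendsto_inv_atTop_zero.comp hlog
  have hnum : Tendsto (fun η : ℝ => Real.log (1 - η * M + η * k) - Real.log M)
      (nhdsWithin (1 / M) (Iio (1 / M)))
      (nhds (Real.log (1 - 1 / M * M + 1 / M * k) - Real.log M)) := by
    refine Tendsto.sub_const (Tendsto.log ?_ ?_) _
    · exact (tendsto_const_nhds.sub (hid.mul_const M)).add (hid.mul_const k)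
    · rw [one_div_mul_cancel hM.ne']
      have : 0 < 1 / M * k := by positivity
      linarith
  have hmul : Tendsto (fun η : ℝ => (η * k)⁻¹) (nhdsWithin (1 / M) (Iio (1 / M)))
      (nhds (1 / M * k)⁻¹) := (hid.mul_const k).inv₀ (by positivity)
  have hmain := (hmul.mul ((hnum.mul hinv).add_const 1)).add (hinv.const_mul C)
  have hlim : (1 / M * k)⁻¹ * ((Real.log (1 - 1 / M * M + 1 / M * k) - Real.log M) * 0 + 1)
      + C * 0 = M / k := by
    field_simp
    ring
  rw [hlim] at hmain
  refine hmain.congr' ?_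
  filter_upwards [Ioo_mem_nhdsLT (one_div_pos.2 hM), hlog.eventually_gt_atTop 0] with η hη hL
  have hη0 : 0 < η := hη.1
  have hA : 0 < 1 - η * M := sub_pos.2 ((lt_div_iff₀ hM).1 hη.2)
  have hε : 0 < 1 / M - η := sub_pos.2 hη.2
  have hI : ∫ x in (0:ℝ)..1, (1 - η * (M - k * x))⁻¹
      = (η * k)⁻¹ * (Real.log (1 - η * M + η * k) - Real.log M - Real.log (1 / M - η)) := by
    have hAε : 1 - η * M = M * (1 / M - η) := by field_simp
    calc ∫ x in (0:ℝ)..1, (1 - η * (M - k * x))⁻¹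
        = ∫ x in (0:ℝ)..1, ((1 - η * M) + (η * k) * x)⁻¹ := by
          congr 1 with x
          ring
      _ = (η * k)⁻¹ * Real.log ((1 - η * M + η * k) / (1 - η * M)) := by
          rw [intervalIntegral.integral_comp_add_mul (fun y => y⁻¹) (by positivity),
            integral_inv_of_pos (by simpa using hA) (by positivity)]
          simp
      _ = _ := by
          rw [Real.log_div (by positivity) hA.ne']
          conv_lhs => rw [show Real.log (1 - η * M) = Real.log M + Real.log (1 / M - η) by
            rw [hAε, Real.log_mul hM.ne' hε.ne']]
          ring
  have hL' : Real.log (1 / M - η) ≠ 0 := (neg_pos.1 hL).ne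
  rw [hI]
  simp only [Function.comp_apply]
  generalize Real.log (1 / M - η) = L at hL'
  field_simp
  ring

/-- (Asymptotic estimate (3.27).) If `f₀` is `C²` on `[0,1]`, its
derivative attains its positive maximum `M₀` only at `x = 0`, and `f₀''(0) < 0`, then with
`η* = 1/M₀`,
`∫₀¹ (1 - η f₀'(x))⁻¹ dx / (-ln(η* - η)) → M₀ / |f₀''(0)|` as `η → η*⁻`. -/
theorem stmt11 (f₀ f₀d f₀dd : ℝ → ℝ)
    (hf₀d : ∀ x ∈ Icc (0:ℝ) 1, HasDerivAt f₀ (f₀d x) x)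
    (hf₀dd : ∀ x ∈ Icc (0:ℝ) 1, HasDerivAt f₀d (f₀dd x) x)
    (hf₀ddc : ContinuousOn f₀dd (Icc (0:ℝ) 1))
    (M₀ : ℝ) (hM₀pos : 0 < M₀)
    (hub : ∀ x ∈ Icc (0:ℝ) 1, f₀d x ≤ M₀)
    (hatt : f₀d 0 = M₀)
    (honly : ∀ x ∈ Icc (0:ℝ) 1, x ≠ 0 → f₀d x < M₀)
    (hvort : f₀dd 0 < 0) :
    Tendsto
      (fun η : ℝ =>
        (∫ x in (0:ℝ)..1, (1 - η * f₀d x)⁻¹) / (-Real.log (1 / M₀ - η)))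
      (nhdsWithin (1 / M₀) (Iio (1 / M₀)))
      (nhds (M₀ / |f₀dd 0|)) := by
  have hcont : ContinuousOn f₀d (Icc 0 1) := fun x hx =>
    (hf₀dd x hx).continuousAt.continuousWithinAt
  have hlin (k : ℝ) : ContinuousOn (fun x : ℝ => M₀ - k * x) (Icc 0 1) := by fun_prop
  have hlin_le {k : ℝ} (hk : 0 < k) : ∀ x ∈ Icc (0:ℝ) 1, M₀ - k * x ≤ M₀ := fun x hx => by
    have := mul_nonneg hk.le hx.1
    linarith
  have hlin_lt {k : ℝ} (hk : 0 < k) : ∀ x ∈ Ioc (0:ℝ) 1, M₀ - k * x < M₀ := fun x hx => by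
    have := mul_pos hk hx.1
    linarith
  have hslope : Tendsto (fun x => x⁻¹ * (f₀d x - M₀)) (nhdsWithin 0 (Ioi 0))
      (nhds (f₀dd 0)) := by
    simpa [hatt] using (hf₀dd 0 (by simp)).tendsto_slope_zero_right
  have hGE {P : ℝ → Prop} (h0 : P 0) (h : ∀ᶠ x in nhdsWithin (0:ℝ) (Ioi 0), P x) :
      ∀ᶠ x in nhdsWithin (0:ℝ) (Ici 0), P x := by
    rw [← Ioi_insert, nhdsWithin_insert, eventually_sup]
    exact ⟨by simpa using h0, h⟩
  have hc : 0 < |f₀dd 0| := abs_pos.2 hvort.ne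
  have habs : |f₀dd 0| = -f₀dd 0 := abs_of_neg hvort
  have hdiv : Tendsto (fun k : ℝ => M₀ / k) (nhds |f₀dd 0|) (nhds (M₀ / |f₀dd 0|)) :=
    tendsto_const_nhds.div tendsto_id hc.ne'
  have hlogpos : ∀ᶠ η in nhdsWithin (1 / M₀) (Iio (1 / M₀)), 0 < -Real.log (1 / M₀ - η) := by
    have hlt : 1 / M₀ - 1 < 1 / M₀ := by linarith
    filter_upwards [Ioo_mem_nhdsLT hlt] with η hη
    exact neg_pos.2 (Real.log_neg (by linarith [hη.2]) (by linarith [hη.1]))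
  refine tendsto_order.2 ⟨fun a ha => ?_, fun b hb => ?_⟩
  · obtain ⟨k, hak, hk⟩ : ∃ k, a < M₀ / k ∧ |f₀dd 0| < k :=
      (((hdiv.mono_left nhdsWithin_le_nhds).eventually_const_lt ha).and
        (self_mem_nhdsWithin : Ioi |f₀dd 0| ∈ nhdsWithin |f₀dd 0| (Ioi |f₀dd 0|))).exists
    have hk0 := hc.trans hk
    obtain ⟨C, hC⟩ := exists_integral_inv_one_sub_mul_le_add hM₀pos (hlin k) hcont
      (hlin_le hk0) hub (hlin_lt hk0) (hGE (by simp [hatt]) (by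
        filter_upwards [hslope.eventually_const_lt (show -k < f₀dd 0 by linarith),
          self_mem_nhdsWithin] with x hx hx0
        rw [← div_eq_inv_mul, lt_div_iff₀ hx0] at hx
        linarith))
    filter_upwards [hC, hlogpos, (tendsto_integral_inv_linear_add_div_log hM₀pos hk0
      (-C)).eventually_const_lt hak] with η h1 h2 h3
    refine h3.trans_le ?_
    gcongr
    linarith
  · obtain ⟨k, ⟨hkb, hk0⟩, hk⟩ : ∃ k, (M₀ / k < b ∧ 0 < k) ∧ k < |f₀dd 0| :=
      ((((hdiv.mono_left nhdsWithin_le_nhds).eventually_lt_const hb).and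
        (nhdsWithin_le_nhds (lt_mem_nhds hc))).and
        (self_mem_nhdsWithin : Iio |f₀dd 0| ∈ nhdsWithin |f₀dd 0| (Iio |f₀dd 0|))).exists
    obtain ⟨C, hC⟩ := exists_integral_inv_one_sub_mul_le_add hM₀pos hcont (hlin k)
      hub (hlin_le hk0) (fun x hx => honly x (Ioc_subset_Icc_self hx) hx.1.ne')
      (hGE (by simp [hatt]) (by
        filter_upwards [hslope.eventually_lt_const (show f₀dd 0 < -k by linarith),
          self_mem_nhdsWithin] with x hx hx0
        rw [← div_eq_inv_mul, div_lt_iff₀ hx0] at hx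
        linarith))
    filter_upwards [hC, hlogpos, (tendsto_integral_inv_linear_add_div_log hM₀pos hk0
      C).eventually_lt_const hkb] with η h1 h2 h3
    refine lt_of_le_of_lt ?_ h3
    gcongr
end

section
/- Let f₀ : [0,1] → ℝ be twice continuously differentiable such that M₀ := max_{x∈[0,1]} f₀'(x) > 0 is attained only at x = 0 and f₀''(0) < 0, and set η* = 1/M₀. Then lim_{η → η*⁻} (1 - η M₀) · ∫₀¹ (1 - η f₀'(x))^{-1} dx = 0; equivalently, the lower bound ( ∫₀¹ (1 - η f₀'(x))^{-1} dx )^{-1} · (1 - η M₀)^{-1} for the flow Jacobian at x = 0 diverges to +∞ as η → η*⁻. -/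
open Set MeasureTheory Filter

/-- (Divergence estimate (3.29).) If `f₀` is `C²` on `[0,1]`, its
derivative attains its positive maximum `M₀` only at `x = 0`, and `f₀''(0) < 0`, then with
`η* = 1/M₀`, `(1 - η M₀) ∫₀¹ (1 - η f₀'(x))⁻¹ dx → 0` as `η → η*⁻`; equivalently, the
lower bound `(∫₀¹ (1 - η f₀'(x))⁻¹ dx)⁻¹ (1 - η M₀)⁻¹` for the flow Jacobian at `x = 0`
diverges to `+∞` as `η → η*⁻`. -/
theorem stmt12 (f₀ f₀d f₀dd : ℝ → ℝ)
    (hf₀d : ∀ x ∈ Icc (0:ℝ) 1, HasDerivAt f₀ (f₀d x) x)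
    (hf₀dd : ∀ x ∈ Icc (0:ℝ) 1, HasDerivAt f₀d (f₀dd x) x)
    (hf₀ddc : ContinuousOn f₀dd (Icc (0:ℝ) 1))
    (M₀ : ℝ) (hM₀pos : 0 < M₀)
    (hub : ∀ x ∈ Icc (0:ℝ) 1, f₀d x ≤ M₀)
    (hatt : f₀d 0 = M₀)
    (honly : ∀ x ∈ Icc (0:ℝ) 1, x ≠ 0 → f₀d x < M₀)
    (hvort : f₀dd 0 < 0) :
    Tendsto
      (fun η : ℝ => (1 - η * M₀) * ∫ x in (0:ℝ)..1, (1 - η * f₀d x)⁻¹)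
      (nhdsWithin (1 / M₀) (Iio (1 / M₀))) (nhds 0) ∧
    Tendsto
      (fun η : ℝ => (∫ x in (0:ℝ)..1, (1 - η * f₀d x)⁻¹)⁻¹ * (1 - η * M₀)⁻¹)
      (nhdsWithin (1 / M₀) (Iio (1 / M₀))) atTop := by
  have hpos : ∀ η ∈ Ioo 0 (1 / M₀), 0 < 1 - η * M₀ := by
    intro η hη
    have := (lt_div_iff₀ hM₀pos).1 hη.2
    linarith
  have hle : ∀ η ∈ Ioo 0 (1 / M₀), ∀ x ∈ Icc (0:ℝ) 1, 1 - η * M₀ ≤ 1 - η * f₀d x := by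
    intro η hη x hx
    have := mul_le_mul_of_nonneg_left (hub x hx) hη.1.le
    linarith
  have hcont : ∀ η ∈ Ioo 0 (1 / M₀),
      ContinuousOn (fun x => (1 - η * f₀d x)⁻¹) (Icc (0:ℝ) 1) := by
    intro η hη
    have hf : ContinuousOn f₀d (Icc (0:ℝ) 1) :=
      fun x hx => (hf₀dd x hx).continuousAt.continuousWithinAt
    exact (continuousOn_const.sub (continuousOn_const.mul hf)).inv₀
      fun x hx => ((hpos η hη).trans_le (hle η hη x hx)).ne'
  have hev : ∀ᶠ η in nhdsWithin (1 / M₀) (Iio (1 / M₀)), η ∈ Ioo 0 (1 / M₀) :=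
    Ioo_mem_nhdsLT (one_div_pos.2 hM₀pos)
  have hsub : uIoc (0:ℝ) 1 ⊆ Icc 0 1 := by
    rw [uIoc_of_le zero_le_one]
    exact Ioc_subset_Icc_self
  have hlim : Tendsto (fun η : ℝ => (1 - η * M₀) * ∫ x in (0:ℝ)..1, (1 - η * f₀d x)⁻¹)
      (nhdsWithin (1 / M₀) (Iio (1 / M₀))) (nhds 0) := by
    simp only [← intervalIntegral.integral_const_mul]
    suffices h : Tendsto (fun η : ℝ => ∫ x in (0:ℝ)..1, (1 - η * M₀) * (1 - η * f₀d x)⁻¹)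
        (nhdsWithin (1 / M₀) (Iio (1 / M₀))) (nhds (∫ _ in (0:ℝ)..1, (0:ℝ))) by
      rwa [intervalIntegral.integral_zero] at h
    refine intervalIntegral.tendsto_integral_filter_of_dominated_convergence (fun _ => 1)
      ?_ ?_ intervalIntegrable_const ?_
    · filter_upwards [hev] with η hη
      exact ((continuousOn_const.mul (hcont η hη)).mono hsub).aestronglyMeasurable
        measurableSet_uIoc
    · filter_upwards [hev] with η hη
      refine Eventually.of_forall fun x hx => ?_
      have h1 := hpos η hη
      have h2 := hle η hη x (hsub hx)
      have h3 := h1.trans_le h2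
      rw [Real.norm_of_nonneg (by positivity), ← div_eq_mul_inv]
      exact (div_le_one h3).2 h2
    · refine Eventually.of_forall fun x hx => ?_
      have hx0 : x ≠ 0 := by
        rw [uIoc_of_le zero_le_one] at hx
        exact hx.1.ne'
      have hne : 1 - 1 / M₀ * f₀d x ≠ 0 := by
        have h := honly x (hsub hx) hx0
        rw [one_div_mul_eq_div]
        exact (sub_pos.2 ((div_lt_one hM₀pos).2 h)).ne'
      have hc : ContinuousAt (fun η : ℝ => (1 - η * M₀) * (1 - η * f₀d x)⁻¹) (1 / M₀) :=
        ContinuousAt.mul (by fun_prop) (ContinuousAt.inv₀ (by fun_prop) hne)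
      have ht := hc.tendsto.mono_left (nhdsWithin_le_nhds (s := Iio (1 / M₀)))
      simpa [hM₀pos.ne'] using ht
  refine ⟨hlim, ?_⟩
  have hgt : ∀ᶠ η in nhdsWithin (1 / M₀) (Iio (1 / M₀)),
      (1 - η * M₀) * (∫ x in (0:ℝ)..1, (1 - η * f₀d x)⁻¹) ∈ Ioi (0:ℝ) := by
    filter_upwards [hev] with η hη
    refine mul_pos (hpos η hη) ?_
    refine intervalIntegral.intervalIntegral_pos_of_pos_on
      ((hcont η hη).intervalIntegrable_of_Icc zero_le_one) (fun x hx => ?_) zero_lt_one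
    exact inv_pos.2 ((hpos η hη).trans_le (hle η hη x (Ioo_subset_Icc_self hx)))
  simpa only [Function.comp_def, mul_inv_rev] using
    tendsto_inv_nhdsGT_zero.comp (tendsto_nhdsWithin_iff.2 ⟨hlim, hgt⟩)
end

section
/- Let f₀ : [0,1] → ℝ be twice continuously differentiable such that M₀ := max_{x∈[0,1]} f₀'(x) > 0 is attained only at points of {0,1}, with f₀''(x*) ≠ 0 at each such point x*, and set η* = 1/M₀. Then ∫₀^{η*} ( ∫₀¹ (1 - μ f₀'(x))^{-1} dx )² dμ < +∞. -/
open Set MeasureTheory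

theorem eventually_mul_abs_sub_le_abs_of_hasDerivAt {h : ℝ → ℝ} {d p : ℝ}
    (hd : HasDerivAt h d p) (hp : h p = 0) (hd0 : d ≠ 0) :
    ∀ᶠ x in nhds p, |d| / 2 * |x - p| ≤ |h x| := by
  have h1 := (hasDerivAt_iff_isLittleO.mp hd).def (half_pos (abs_pos.mpr hd0))
  filter_upwards [h1] with x hx
  simp only [hp, sub_zero, smul_eq_mul, Real.norm_eq_abs] at hx
  have h2 : |(x - p) * d| ≤ |h x| + |h x - (x - p) * d| := by
    have := abs_sub (h x) (h x - (x - p) * d)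
    simpa using this
  rw [abs_mul] at h2
  nlinarith

/-- A nonnegative function on `[0, 1]`, positive on `(0, 1)`, whose zeros at the endpoints are
simple is bounded below by a positive multiple of `x * (1 - x)`. -/
theorem exists_pos_mul_le_of_simple_endpoint_zeros {h h' : ℝ → ℝ}
    (hd : ∀ x ∈ Icc (0:ℝ) 1, HasDerivAt h (h' x) x)
    (hnonneg : ∀ x ∈ Icc (0:ℝ) 1, 0 ≤ h x)
    (hpos : ∀ x ∈ Ioo (0:ℝ) 1, 0 < h x)
    (h0 : h 0 = 0 → h' 0 ≠ 0) (h1 : h 1 = 0 → h' 1 ≠ 0) :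
    ∃ c > 0, ∀ x ∈ Icc (0:ℝ) 1, c * (x * (1 - x)) ≤ h x := by
  have key : ∃ c > 0, ∀ x ∈ Icc (0:ℝ) 1, x ∈ Icc (0:ℝ) 1 → c * (x * (1 - x)) ≤ h x := by
    refine isCompact_Icc.induction_on
      (p := fun s => ∃ c > 0, ∀ x ∈ s, x ∈ Icc (0:ℝ) 1 → c * (x * (1 - x)) ≤ h x)
      ⟨1, one_pos, by simp⟩ ?_ ?_ ?_
    · rintro s t hst ⟨c, hc, hct⟩
      exact ⟨c, hc, fun x hx => hct x (hst hx)⟩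
    · rintro s t ⟨c, hc, hcs⟩ ⟨c', hc', hct⟩
      refine ⟨min c c', lt_min hc hc', ?_⟩
      rintro x (hx | hx) hxI
      · refine le_trans ?_ (hcs x hx hxI)
        exact mul_le_mul_of_nonneg_right (min_le_left _ _)
          (mul_nonneg hxI.1 (sub_nonneg.mpr hxI.2))
      · refine le_trans ?_ (hct x hx hxI)
        exact mul_le_mul_of_nonneg_right (min_le_right _ _)
          (mul_nonneg hxI.1 (sub_nonneg.mpr hxI.2))
    · intro p hp
      rcases (hnonneg p hp).eq_or_lt' with hz | hz
      · have hp01 : p = 0 ∨ p = 1 := by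
          by_contra! hne
          exact (hpos p ⟨lt_of_le_of_ne hp.1 hne.1.symm, lt_of_le_of_ne hp.2 hne.2⟩).ne' hz
        have hd0 : h' p ≠ 0 := by
          rcases hp01 with rfl | rfl
          · exact h0 hz
          · exact h1 hz
        refine ⟨_, mem_nhdsWithin_of_mem_nhds
          (eventually_mul_abs_sub_le_abs_of_hasDerivAt (hd p hp) hz hd0),
          |h' p| / 2, half_pos (abs_pos.mpr hd0), fun x hx hxI => ?_⟩
        have hx' : |h' p| / 2 * |x - p| ≤ |h x| := hx
        rw [abs_of_nonneg (hnonneg x hxI)] at hx'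
        refine le_trans (mul_le_mul_of_nonneg_left ?_ (by positivity)) hx'
        obtain ⟨hx0, hx1⟩ := hxI
        rcases hp01 with rfl | rfl
        · rw [sub_zero, abs_of_nonneg hx0]
          nlinarith
        · rw [abs_of_nonpos (by linarith)]
          nlinarith
      · refine ⟨_, mem_nhdsWithin_of_mem_nhds
          ((hd p hp).continuousAt.eventually (lt_mem_nhds (half_lt_self hz))),
          h p / 2, half_pos hz, fun x hx hxI => ?_⟩
        have hx' : h p / 2 < h x := hx
        obtain ⟨hx0, hx1⟩ := hxI
        have : x * (1 - x) ≤ 1 := by nlinarith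
        nlinarith
  obtain ⟨c, hc, hcx⟩ := key
  exact ⟨c, hc, fun x hx => hcx x hx hx⟩

theorem intervalIntegrable_rpow_mul_one_sub {r : ℝ} (hr : -1 < r) :
    IntervalIntegrable (fun x : ℝ => (x * (1 - x)) ^ r) volume 0 1 := by
  have hc : 0 < ((r + 1 : ℝ) : ℂ).re := by simpa using by linarith
  refine (Complex.betaIntegral_convergent hc hc).norm.congr ?_
  intro x hx
  rw [uIoc_of_le zero_le_one] at hx
  have h1 : 0 ≤ 1 - x := sub_nonneg.mpr hx.2
  have hr1 : ((r + 1 : ℝ) : ℂ) - 1 = (r : ℂ) := by push_cast; ring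
  have hx1 : (1 : ℂ) - (x : ℂ) = ((1 - x : ℝ) : ℂ) := by push_cast; ring
  simp only [hr1, hx1]
  rw [← Complex.ofReal_cpow hx.1.le, ← Complex.ofReal_cpow h1, ← Complex.ofReal_mul,
    Complex.norm_real, ← Real.mul_rpow hx.1.le h1, Real.norm_of_nonneg]
  exact Real.rpow_nonneg (mul_nonneg hx.1.le h1) r

theorem stronglyMeasurable_intervalIntegral_inv_one_sub_mul {g : ℝ → ℝ}
    (hg : ContinuousOn g (Icc (0:ℝ) 1)) :
    StronglyMeasurable (fun μ : ℝ => ∫ x in (0:ℝ)..1, (1 - μ * g x)⁻¹) := by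
  have hm : Measurable ((Icc (0:ℝ) 1).indicator g) := by
    classical
    rw [← piecewise_eq_indicator]
    exact hg.measurable_piecewise continuousOn_const measurableSet_Icc
  have h2 : Measurable (fun q : ℝ × ℝ => (1 - q.1 * (Icc (0:ℝ) 1).indicator g q.2)⁻¹) := by
    fun_prop
  have h3 := h2.stronglyMeasurable.integral_prod_right' (ν := volume.restrict (Ioc (0:ℝ) 1))
  refine (congrArg StronglyMeasurable (funext fun μ => ?_)).mp h3
  rw [intervalIntegral.integral_of_le zero_le_one]
  refine setIntegral_congr_fun measurableSet_Ioc fun x hx => ?_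
  simp [indicator_of_mem (Ioc_subset_Icc_self hx)]

theorem inv_le_rpow_mul_rpow {a b A r s : ℝ} (ha : 0 < a) (hb : 0 < b) (haA : a ≤ A)
    (hbA : b ≤ A) (hr : 0 ≤ r) (hs : 0 ≤ s) (hrs : r + s = 1) :
    A⁻¹ ≤ a ^ (-r) * b ^ (-s) := by
  have hA : 0 < A := ha.trans_le haA
  rw [Real.rpow_neg ha.le, Real.rpow_neg hb.le, ← mul_inv]
  refine inv_anti₀ (by positivity) ?_
  calc a ^ r * b ^ s ≤ A ^ r * A ^ s := by gcongr
    _ = A := by rw [← Real.rpow_add hA, hrs, Real.rpow_one]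

/-- (Finiteness of the blowup-time upper bound (3.35).) If `f₀` is `C²`
on `[0,1]` and its derivative attains its positive maximum `M₀` only at points of `{0,1}`,
at each of which `f₀'' ≠ 0`, then, with `η* = 1/M₀`,
`∫₀^{η*} (∫₀¹ (1 - μ f₀'(x))⁻¹ dx)² dμ < ∞`, expressed as interval integrability. -/
theorem stmt13 (f₀ f₀d f₀dd : ℝ → ℝ)
    (hf₀d : ∀ x ∈ Icc (0:ℝ) 1, HasDerivAt f₀ (f₀d x) x)
    (hf₀dd : ∀ x ∈ Icc (0:ℝ) 1, HasDerivAt f₀d (f₀dd x) x)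
    (hf₀ddc : ContinuousOn f₀dd (Icc (0:ℝ) 1))
    (M₀ : ℝ) (hM₀pos : 0 < M₀)
    (hub : ∀ x ∈ Icc (0:ℝ) 1, f₀d x ≤ M₀)
    (hatt : f₀d 0 = M₀ ∨ f₀d 1 = M₀)
    (honly : ∀ x ∈ Ioo (0:ℝ) 1, f₀d x < M₀)
    (hvort0 : f₀d 0 = M₀ → f₀dd 0 ≠ 0)
    (hvort1 : f₀d 1 = M₀ → f₀dd 1 ≠ 0) :
    IntervalIntegrable
      (fun μ : ℝ => (∫ x in (0:ℝ)..1, (1 - μ * f₀d x)⁻¹) ^ 2)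
      MeasureTheory.volume 0 (1 / M₀) := by
  have hdiff : ∀ x ∈ Icc (0:ℝ) 1,
      HasDerivAt (fun x => M₀ - f₀d x) (-f₀dd x) x := fun x hx => (hf₀dd x hx).const_sub M₀
  obtain ⟨c, hc, hcx⟩ := exists_pos_mul_le_of_simple_endpoint_zeros hdiff
    (fun x hx => sub_nonneg.mpr (hub x hx)) (fun x hx => sub_pos.mpr (honly x hx))
    (fun h => neg_ne_zero.mpr (hvort0 (by linarith)))
    (fun h => neg_ne_zero.mpr (hvort1 (by linarith)))
  obtain ⟨k, hk, hk1, hkc⟩ : ∃ k > 0, k ≤ 1 ∧ M₀ * k ≤ c := by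
    refine ⟨min 1 (c / M₀), lt_min one_pos (by positivity), min_le_left _ _, ?_⟩
    rw [← le_div_iff₀' hM₀pos]
    exact min_le_right _ _
  have hcont : ContinuousOn f₀d (Icc (0:ℝ) 1) :=
    fun x hx => (hf₀dd x hx).continuousAt.continuousWithinAt
  have hbeta : IntervalIntegrable (fun x : ℝ => (x * (1 - x)) ^ (-(3/4) : ℝ)) volume 0 1 :=
    intervalIntegrable_rpow_mul_one_sub (by norm_num)
  set K : ℝ := ∫ x in (0:ℝ)..1, k ^ (-(3/4) : ℝ) * (x * (1 - x)) ^ (-(3/4) : ℝ) with hK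
  have hbound : ∀ μ ∈ Ioo (0:ℝ) (1 / M₀),
      0 ≤ (∫ x in (0:ℝ)..1, (1 - μ * f₀d x)⁻¹) ∧
      (∫ x in (0:ℝ)..1, (1 - μ * f₀d x)⁻¹) ≤ (1 - M₀ * μ) ^ (-(1/4) : ℝ) * K := by
    rintro μ ⟨hμ0, hμ1⟩
    have ht : 0 < 1 - M₀ * μ := by
      rw [lt_div_iff₀' hM₀pos] at hμ1
      linarith
    have hle : ∀ x ∈ Icc (0:ℝ) 1, 1 - M₀ * μ ≤ 1 - μ * f₀d x := fun x hx => by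
      nlinarith [hub x hx]
    have hnn : ∀ x ∈ Icc (0:ℝ) 1, 0 ≤ (1 - μ * f₀d x)⁻¹ := fun x hx =>
      inv_nonneg.mpr (ht.le.trans (hle x hx))
    refine ⟨intervalIntegral.integral_nonneg zero_le_one hnn, ?_⟩
    rw [hK, ← intervalIntegral.integral_const_mul]
    rw [intervalIntegral.integral_of_le zero_le_one, intervalIntegral.integral_of_le zero_le_one,
      integral_Ioc_eq_integral_Ioo, integral_Ioc_eq_integral_Ioo]
    refine integral_mono_of_nonneg ?_ ?_ ?_
    · exact ae_restrict_of_forall_mem measurableSet_Ioo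
        fun x hx => hnn x (Ioo_subset_Icc_self hx)
    · exact ((hbeta.const_mul _).const_mul _).1.mono_set Ioo_subset_Ioc_self
    · refine ae_restrict_of_forall_mem measurableSet_Ioo fun x hx => ?_
      have hxI := Ioo_subset_Icc_self hx
      have hy : 0 < x * (1 - x) := mul_pos hx.1 (sub_pos.mpr hx.2)
      have hy1 : k * (x * (1 - x)) ≤ 1 := by
        have : x * (1 - x) ≤ 1 := by nlinarith [hx.1, hx.2]
        nlinarith
      have hgap : M₀ * (k * (x * (1 - x))) ≤ M₀ - f₀d x := by
        refine le_trans ?_ (hcx x hxI)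
        rw [← mul_assoc]
        exact mul_le_mul_of_nonneg_right hkc hy.le
      have hyA : k * (x * (1 - x)) ≤ 1 - μ * f₀d x := by
        nlinarith [mul_le_mul_of_nonneg_left hgap hμ0.le,
          mul_nonneg ht.le (sub_nonneg.mpr hy1)]
      have := inv_le_rpow_mul_rpow ht (mul_pos hk hy) (hle x hxI) hyA
        (r := 1/4) (s := 3/4) (by norm_num) (by norm_num) (by norm_num)
      rwa [Real.mul_rpow hk.le hy.le] at this
  have hdom : IntervalIntegrable (fun μ : ℝ => K ^ 2 * (1 - M₀ * μ) ^ (-(1/2) : ℝ))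
      volume 0 (1 / M₀) := by
    have h1 : IntervalIntegrable (fun x : ℝ => x ^ (-(1/2) : ℝ)) volume 1 0 :=
      intervalIntegral.intervalIntegrable_rpow' (by norm_num)
    have h2 := (h1.comp_sub_left 1).comp_mul_left (c := M₀)
    refine IntervalIntegrable.const_mul ?_ _
    simpa using h2
  rw [intervalIntegrable_iff_integrableOn_Ioo_of_le (by positivity)] at hdom ⊢
  refine hdom.mono' ?_ ?_
  · exact ((stronglyMeasurable_intervalIntegral_inv_one_sub_mul hcont).pow 2).aestronglyMeasurable
  · refine ae_restrict_of_forall_mem measurableSet_Ioo fun μ hμ => ?_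
    obtain ⟨hI0, hI⟩ := hbound μ hμ
    have ht : 0 ≤ 1 - M₀ * μ := by
      have := hμ.2
      rw [lt_div_iff₀' hM₀pos] at this
      linarith
    rw [Real.norm_of_nonneg (by positivity)]
    calc _ ≤ ((1 - M₀ * μ) ^ (-(1/4) : ℝ) * K) ^ 2 := by gcongr
      _ = _ := by
        rw [mul_pow, ← Real.rpow_mul_natCast ht]
        norm_num [mul_comm]
end

section
/- Let f₀, ρ₀ : [0,1] → ℝ be smooth with f₀ not identically zero, f₀(0) = f₀(1) = 0, ρ₀(0) = ρ₀(1) = 0, and ρ₀(x) ≥ 0 for all x ∈ [0,1]. Suppose M₀ := max_{x∈[0,1]} f₀'(x) > 0 is attained only at points of {0,1}, and f₀''(x*) ≠ 0 at each such point x*. Set B := ∫₀^{1/M₀} ( ∫₀¹ (1 - μ f₀'(x))^{-1} dx )² dμ. Then B < +∞, and every classical solution (f, ρ) of the reduced Boussinesq system f_{xt} + f f_{xx} - f_x² + ρ = I(t), ρ_t + f ρ_x = ρ f_x on [0,T) × [0,1], with I(t) = ∫₀¹ ρ(t,x) dx - 2∫₀¹ f_x(t,x)² dx, boundary conditions f(t,0)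 = f(t,1) = 0, ρ(t,0) = ρ(t,1) = 0, and initial data f(0,·) = f₀, ρ(0,·) = ρ₀, satisfies T ≤ B. In particular, no global-in-time classical solution with such initial data exists. -/
open Set MeasureTheory

/-- A classical solution of the reduced Boussinesq system
`f_{xt} + f f_{xx} - f_x² + ρ = I(t)`, `ρ_t + f ρ_x = ρ f_x` on `[0,T) × [0,1]`, where
`I(t) = ∫₀¹ ρ dx - 2 ∫₀¹ f_x² dx`, with Dirichlet boundary conditions
`f(t,0) = f(t,1) = 0` and `ρ(t,0) = ρ(t,1) = 0`.  The functions `fx, fxx, fxt, ρt, ρx`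
are the indicated partial derivatives of `f` and `ρ`. -/
structure IsClassicalSol (T : ℝ) (f ρ fx fxx fxt ρt ρx : ℝ → ℝ → ℝ) : Prop where
  hfx : ∀ t ∈ Ico (0:ℝ) T, ∀ x ∈ Icc (0:ℝ) 1, HasDerivAt (f t) (fx t x) x
  hfxx : ∀ t ∈ Ico (0:ℝ) T, ∀ x ∈ Icc (0:ℝ) 1, HasDerivAt (fx t) (fxx t x) x
  hfxt : ∀ t ∈ Ico (0:ℝ) T, ∀ x ∈ Icc (0:ℝ) 1, HasDerivAt (fun s => fx s x) (fxt t x) t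
  hρt : ∀ t ∈ Ico (0:ℝ) T, ∀ x ∈ Icc (0:ℝ) 1, HasDerivAt (fun s => ρ s x) (ρt t x) t
  hρx : ∀ t ∈ Ico (0:ℝ) T, ∀ x ∈ Icc (0:ℝ) 1, HasDerivAt (ρ t) (ρx t x) x
  hcf : ContinuousOn (fun p : ℝ × ℝ => f p.1 p.2) (Ico (0:ℝ) T ×ˢ Icc (0:ℝ) 1)
  hcρ : ContinuousOn (fun p : ℝ × ℝ => ρ p.1 p.2) (Ico (0:ℝ) T ×ˢ Icc (0:ℝ) 1)
  hcfx : ContinuousOn (fun p : ℝ × ℝ => fx p.1 p.2) (Ico (0:ℝ) T ×ˢ Icc (0:ℝ) 1)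
  hcfxx : ContinuousOn (fun p : ℝ × ℝ => fxx p.1 p.2) (Ico (0:ℝ) T ×ˢ Icc (0:ℝ) 1)
  hcfxt : ContinuousOn (fun p : ℝ × ℝ => fxt p.1 p.2) (Ico (0:ℝ) T ×ˢ Icc (0:ℝ) 1)
  hcρt : ContinuousOn (fun p : ℝ × ℝ => ρt p.1 p.2) (Ico (0:ℝ) T ×ˢ Icc (0:ℝ) 1)
  hcρx : ContinuousOn (fun p : ℝ × ℝ => ρx p.1 p.2) (Ico (0:ℝ) T ×ˢ Icc (0:ℝ) 1)
  hpde1 : ∀ t ∈ Ico (0:ℝ) T, ∀ x ∈ Icc (0:ℝ) 1,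
    fxt t x + f t x * fxx t x - (fx t x) ^ 2 + ρ t x
      = (∫ y in (0:ℝ)..1, ρ t y) - 2 * ∫ y in (0:ℝ)..1, (fx t y) ^ 2
  hpde2 : ∀ t ∈ Ico (0:ℝ) T, ∀ x ∈ Icc (0:ℝ) 1,
    ρt t x + f t x * ρx t x = ρ t x * fx t x
  hbcf : ∀ t ∈ Ico (0:ℝ) T, f t 0 = 0 ∧ f t 1 = 0
  hbcρ : ∀ t ∈ Ico (0:ℝ) T, ρ t 0 = 0 ∧ ρ t 1 = 0

lemma monotoneOn_Icc_of_hasDerivAt {T : ℝ} {g g' : ℝ → ℝ} (hg : ContinuousOn g (Icc 0 T))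
    (hd : ∀ t ∈ Ioo 0 T, HasDerivAt g (g' t) t) (hpos : ∀ t ∈ Ioo 0 T, 0 ≤ g' t) :
    MonotoneOn g (Icc 0 T) := by
  refine monotoneOn_of_hasDerivWithinAt_nonneg (f' := g') (convex_Icc 0 T) hg ?_ ?_ <;>
    rw [interior_Icc]
  exacts [fun t ht => (hd t ht).hasDerivWithinAt, hpos]

lemma le_of_hasDerivAt_nonneg {T : ℝ} {g g' : ℝ → ℝ} (hg : ContinuousOn g (Icc 0 T))
    (hd : ∀ t ∈ Ioo 0 T, HasDerivAt g (g' t) t) (hpos : ∀ t ∈ Ioo 0 T, 0 ≤ g' t)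
    {t : ℝ} (ht : t ∈ Icc 0 T) : g 0 ≤ g t :=
  monotoneOn_Icc_of_hasDerivAt hg hd hpos ⟨le_rfl, ht.1.trans ht.2⟩ ht ht.1

lemma exists_primitive_Icc {T : ℝ} (hT : 0 ≤ T) {g : ℝ → ℝ} (hg : ContinuousOn g (Icc 0 T)) :
    ∃ P : ℝ → ℝ, P 0 = 0 ∧ ContinuousOn P (Icc 0 T) ∧ ∀ t ∈ Ioo 0 T, HasDerivAt P (g t) t := by
  have hc : Continuous fun s => g (max 0 (min T s)) :=
    hg.comp_continuous (by fun_prop) fun s => ⟨le_max_left _ _, max_le hT (min_le_left _ _)⟩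
  have hd (t : ℝ) := intervalIntegral.integral_hasDerivAt_right (hc.intervalIntegrable 0 t)
    (hc.stronglyMeasurableAtFilter _ _) hc.continuousAt
  refine ⟨fun t => ∫ s in 0..t, g (max 0 (min T s)), by simp,
    fun t _ => (hd t).continuousAt.continuousWithinAt, fun t ht => ?_⟩
  have := hd t
  rwa [min_eq_right ht.2.le, max_eq_right ht.1.le] at this

/-- Comparison of two solutions of the Riccati-type equations `d' = d² + J` and
`D' = D² - R + J` with `R' = R D`, `R ≥ 0`, in terms of the primitives `p` of `d`, `P` of `D`
and `q` of `exp (2 p)`. -/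
lemma riccati_comparison {T : ℝ} {d D R J P p q : ℝ → ℝ}
    (hdc : ContinuousOn d (Icc 0 T)) (hDc : ContinuousOn D (Icc 0 T))
    (hRc : ContinuousOn R (Icc 0 T)) (hPc : ContinuousOn P (Icc 0 T))
    (hpc : ContinuousOn p (Icc 0 T)) (hqc : ContinuousOn q (Icc 0 T))
    (hd : ∀ t ∈ Ioo 0 T, HasDerivAt d (d t ^ 2 + J t) t)
    (hD : ∀ t ∈ Ioo 0 T, HasDerivAt D (D t ^ 2 - R t + J t) t)
    (hR : ∀ t ∈ Ioo 0 T, HasDerivAt R (R t * D t) t)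
    (hP : ∀ t ∈ Ioo 0 T, HasDerivAt P (D t) t) (hp : ∀ t ∈ Ioo 0 T, HasDerivAt p (d t) t)
    (hq : ∀ t ∈ Ioo 0 T, HasDerivAt q (Real.exp (2 * p t)) t)
    (hP0 : P 0 = 0) (hp0 : p 0 = 0) (hq0 : q 0 = 0) (hR0 : 0 ≤ R 0)
    {t : ℝ} (ht : t ∈ Icc 0 T) :
    Real.exp (-p t) * (1 + (d 0 - D 0) * q t) ≤ Real.exp (-P t) := by
  have hRpos : ∀ s ∈ Icc 0 T, 0 ≤ R s := by
    intro s hs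
    have key := le_of_hasDerivAt_nonneg (g := fun s => R s * Real.exp (-P s)) (g' := fun _ => 0)
      (by fun_prop) (fun s hs => by
        have := (hR s hs).mul (hP s hs).neg.exp
        convert! this using 1
        simp only [Pi.neg_apply]; ring) (fun _ _ => le_rfl) hs
    simp only [hP0, neg_zero, Real.exp_zero, mul_one] at key
    exact nonneg_of_mul_nonneg_left (hR0.trans key) (Real.exp_pos _)
  have hg : ∀ s ∈ Icc 0 T, d 0 - D 0 ≤ Real.exp (-P s - p s) * (d s - D s) := by
    intro s hs
    have key := le_of_hasDerivAt_nonneg (g := fun s => Real.exp (-P s - p s) * (d s - D s))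
      (g' := fun s => Real.exp (-P s - p s) * R s)
      (by fun_prop) (fun s hs => by
        have := ((hP s hs).neg.sub (hp s hs)).exp.mul ((hd s hs).sub (hD s hs))
        convert! this using 1
        simp only [Pi.neg_apply, Pi.sub_apply]; ring)
      (fun s hs => mul_nonneg (Real.exp_pos _).le (hRpos s (Ioo_subset_Icc_self hs))) hs
    simpa [hP0, hp0] using key
  have key := le_of_hasDerivAt_nonneg
    (g := fun s => Real.exp (p s - P s) - (d 0 - D 0) * q s)
    (g' := fun s => Real.exp (2 * p s) * (Real.exp (-P s - p s) * (d s - D s) - (d 0 - D 0)))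
    (by fun_prop) (fun s hs => by
      have := ((hp s hs).sub (hP s hs)).exp.sub ((hq s hs).const_mul (d 0 - D 0))
      convert! this using 1
      simp only [Pi.sub_apply]
      have : Real.exp (p s - P s) = Real.exp (2 * p s) * Real.exp (-P s - p s) := by
        rw [← Real.exp_add]; ring_nf
      rw [this]; ring)
    (fun s hs => mul_nonneg (Real.exp_pos _).le
      (sub_nonneg.2 (hg s (Ioo_subset_Icc_self hs)))) ht
  simp only [hP0, hp0, hq0, sub_zero, Real.exp_zero, mul_zero] at key
  have e : Real.exp (-P t) = Real.exp (-p t) * Real.exp (p t - P t) := by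
    rw [← Real.exp_add]; ring_nf
  rw [e]
  exact mul_le_mul_of_nonneg_left (by linarith) (Real.exp_pos _).le

/-- Two-sided exponential bound on the distance between two trajectories of a Lipschitz field. -/
lemma sq_sub_bounds {T L : ℝ} {u v u' v' : ℝ → ℝ}
    (huc : ContinuousOn u (Icc 0 T)) (hvc : ContinuousOn v (Icc 0 T))
    (hu : ∀ t ∈ Ioo 0 T, HasDerivAt u (u' t) t) (hv : ∀ t ∈ Ioo 0 T, HasDerivAt v (v' t) t)
    (hL : ∀ t ∈ Ioo 0 T, |u' t - v' t| ≤ L * |u t - v t|) {t : ℝ} (ht : t ∈ Icc 0 T) :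
    (u t - v t) ^ 2 ≤ Real.exp (2 * L * t) * (u 0 - v 0) ^ 2 ∧
      (u 0 - v 0) ^ 2 ≤ Real.exp (2 * L * t) * (u t - v t) ^ 2 := by
  have hder : ∀ s ∈ Ioo 0 T, |(u s - v s) * (u' s - v' s)| ≤ L * (u s - v s) ^ 2 := by
    intro s hs
    rw [abs_mul, ← sq_abs (u s - v s)]
    nlinarith [hL s hs, abs_nonneg (u s - v s)]
  have hd (c s : ℝ) (hs : s ∈ Ioo 0 T) :
      HasDerivAt (fun s => Real.exp (c * s) * (u s - v s) ^ 2)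
        (Real.exp (c * s) * (c * (u s - v s) ^ 2 + 2 * ((u s - v s) * (u' s - v' s)))) s := by
    have := ((hasDerivAt_id s).const_mul c).exp.mul (((hu s hs).sub (hv s hs)).pow 2)
    convert! this using 1
    simp; ring
  constructor
  · have key := le_of_hasDerivAt_nonneg
      (g := fun s => -(Real.exp (-(2 * L) * s) * (u s - v s) ^ 2)) (by fun_prop)
      (fun s hs => (hd (-(2 * L)) s hs).neg) (fun s hs => by
        rw [neg_nonneg]
        refine mul_nonpos_of_nonneg_of_nonpos (Real.exp_pos _).le ?_
        linarith [(abs_le.1 (hder s hs)).2]) ht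
    simp only [mul_zero, Real.exp_zero, one_mul, neg_le_neg_iff] at key
    have e : (u t - v t) ^ 2
        = Real.exp (2 * L * t) * (Real.exp (-(2 * L) * t) * (u t - v t) ^ 2) := by
      rw [← mul_assoc, ← Real.exp_add]; simp
    rw [e]
    exact mul_le_mul_of_nonneg_left key (Real.exp_pos _).le
  · have key := le_of_hasDerivAt_nonneg
      (g := fun s => Real.exp (2 * L * s) * (u s - v s) ^ 2) (by fun_prop)
      (fun s hs => hd (2 * L) s hs) (fun s hs => by
        refine mul_nonneg (Real.exp_pos _).le ?_
        linarith [(abs_le.1 (hder s hs)).1]) ht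
    simpa using key

lemma pos_of_continuousOn_of_ne_zero {T : ℝ} {k : ℝ → ℝ} (hk : ContinuousOn k (Icc 0 T))
    (h0 : 0 < k 0) (hne : ∀ t ∈ Icc 0 T, k t ≠ 0) {t : ℝ} (ht : t ∈ Icc 0 T) : 0 < k t := by
  by_contra! h
  obtain ⟨s, hs, hks⟩ := intermediate_value_Icc' ht.1
    (hk.mono (Icc_subset_Icc_right ht.2)) ⟨h, h0.le⟩
  exact hne s ⟨hs.1, hs.2.trans ht.2⟩ hks

lemma trajectory_lt {T L : ℝ} {u v u' v' : ℝ → ℝ}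
    (huc : ContinuousOn u (Icc 0 T)) (hvc : ContinuousOn v (Icc 0 T))
    (hu : ∀ t ∈ Ioo 0 T, HasDerivAt u (u' t) t) (hv : ∀ t ∈ Ioo 0 T, HasDerivAt v (v' t) t)
    (hL : ∀ t ∈ Ioo 0 T, |u' t - v' t| ≤ L * |u t - v t|) (h0 : v 0 < u 0)
    {t : ℝ} (ht : t ∈ Icc 0 T) : v t < u t := by
  refine sub_pos.1 (pos_of_continuousOn_of_ne_zero (k := fun s => u s - v s) (huc.sub hvc)
    (sub_pos.2 h0) (fun s hs h => ?_) ht)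
  have := (sq_sub_bounds huc hvc hu hv hL hs).2
  simp only [h] at this
  nlinarith [sub_pos.2 h0]

/-- Global solutions of a scalar ODE with bounded, globally Lipschitz right-hand side. -/
lemma exists_trajectory {T L C : ℝ} (hT : 0 ≤ T) (hL : 0 ≤ L) (hC : 0 ≤ C) {F : ℝ → ℝ → ℝ}
    (hFc : ∀ y, Continuous (F · y)) (hlip : ∀ t x y, |F t x - F t y| ≤ L * |x - y|)
    (hbd : ∀ t y, |F t y| ≤ C) (x : ℝ) :
    ∃ u : ℝ → ℝ, u 0 = x ∧ ContinuousOn u (Icc 0 T) ∧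
      ∀ t ∈ Ioo 0 T, HasDerivAt u (F t (u t)) t := by
  have hPL : IsPicardLindelof F (⟨0, le_rfl, hT⟩ : Icc 0 T) x (C * T).toNNReal 0
      C.toNNReal L.toNNReal :=
    { lipschitzOnWith := fun t _ => (LipschitzWith.of_dist_le_mul fun y z => by
        rw [Real.dist_eq, Real.dist_eq, Real.coe_toNNReal _ hL]; exact hlip t y z).lipschitzOnWith
      continuousOn := fun y _ => (hFc y).continuousOn
      norm_le := fun t _ y _ => by rw [Real.coe_toNNReal _ hC]; exact hbd t y
      mul_max_le := by
        rw [Real.coe_toNNReal _ hC, Real.coe_toNNReal _ (mul_nonneg hC hT)]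
        simp [hT] }
  obtain ⟨u, hu0, hu⟩ := hPL.exists_eq_forall_mem_Icc_hasDerivWithinAt₀
  exact ⟨u, hu0, fun t ht => (hu t ht).continuousWithinAt,
    fun t ht => (hu t (Ioo_subset_Icc_self ht)).hasDerivAt (Icc_mem_nhds ht.1 ht.2)⟩

lemma abs_sub_le_of_hasDerivAt_Icc {L : ℝ} {g g' : ℝ → ℝ}
    (hg : ∀ x ∈ Icc (0:ℝ) 1, HasDerivAt g (g' x) x) (hL : ∀ x ∈ Icc (0:ℝ) 1, |g' x| ≤ L)
    {a b : ℝ} (ha : a ∈ Icc (0:ℝ) 1) (hb : b ∈ Icc (0:ℝ) 1) : |g a - g b| ≤ L * |a - b| :=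
  (convex_Icc (0:ℝ) 1).norm_image_sub_le_of_norm_hasDerivWithin_le
    (fun x hx => (hg x hx).hasDerivWithinAt) hL hb ha

/-- `γ x` is the trajectory of the velocity field `f` on `[0, 1]` which starts at `x`. -/
structure IsFlow (T : ℝ) (f γ : ℝ → ℝ → ℝ) : Prop where
  initial : ∀ x ∈ Icc (0:ℝ) 1, γ x 0 = x
  cont : ∀ x ∈ Icc (0:ℝ) 1, ContinuousOn (γ x) (Icc 0 T)
  deriv : ∀ x ∈ Icc (0:ℝ) 1, ∀ t ∈ Ioo 0 T, HasDerivAt (γ x) (f t (γ x t)) t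
  mem_Ioo : ∀ x ∈ Ioo (0:ℝ) 1, ∀ t ∈ Icc 0 T, γ x t ∈ Ioo (0:ℝ) 1
  left : ∀ t ∈ Icc 0 T, γ 0 t = 0
  right : ∀ t ∈ Icc 0 T, γ 1 t = 1

lemma IsFlow.mem_Icc {T : ℝ} {f γ : ℝ → ℝ → ℝ} (h : IsFlow T f γ) {x t : ℝ}
    (hx : x ∈ Icc (0:ℝ) 1) (ht : t ∈ Icc 0 T) : γ x t ∈ Icc (0:ℝ) 1 := by
  rcases hx.1.eq_or_lt with rfl | h0
  · simp [h.left t ht]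
  rcases hx.2.eq_or_lt with rfl | h1
  · simp [h.right t ht]
  exact Ioo_subset_Icc_self (h.mem_Ioo x ⟨h0, h1⟩ t ht)

lemma exists_isFlow {T L : ℝ} (hT : 0 ≤ T) {f fx : ℝ → ℝ → ℝ}
    (hf : ∀ t ∈ Icc (0:ℝ) T, ∀ x ∈ Icc (0:ℝ) 1, HasDerivAt (f t) (fx t x) x)
    (hcf : ContinuousOn (fun p : ℝ × ℝ => f p.1 p.2) (Icc (0:ℝ) T ×ˢ Icc (0:ℝ) 1))
    (hL : ∀ t ∈ Icc (0:ℝ) T, ∀ x ∈ Icc (0:ℝ) 1, |fx t x| ≤ L)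
    (hb : ∀ t ∈ Icc (0:ℝ) T, f t 0 = 0 ∧ f t 1 = 0) : ∃ γ, IsFlow T f γ := by
  have hmem (a y : ℝ) (ha : 0 ≤ a) : max 0 (min a y) ∈ Icc 0 a :=
    ⟨le_max_left _ _, max_le ha (min_le_left _ _)⟩
  have hid (a y : ℝ) (hy : y ∈ Icc 0 a) : max 0 (min a y) = y := by
    rw [min_eq_right hy.2, max_eq_right hy.1]
  have hL0 : 0 ≤ L := (abs_nonneg _).trans (hL 0 ⟨le_rfl, hT⟩ 0 (by simp))
  set F : ℝ → ℝ → ℝ := fun t y => f (max 0 (min T t)) (max 0 (min 1 y)) with hF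
  have hFeq (t y : ℝ) (ht : t ∈ Icc 0 T) (hy : y ∈ Icc (0:ℝ) 1) : F t y = f t y := by
    simp only [hF, hid T t ht, hid 1 y hy]
  have hlip : ∀ t x y, |F t x - F t y| ≤ L * |x - y| := by
    intro t x y
    refine (abs_sub_le_of_hasDerivAt_Icc (hf _ (hmem T t hT)) (hL _ (hmem T t hT))
      (hmem 1 x zero_le_one) (hmem 1 y zero_le_one)).trans
      (mul_le_mul_of_nonneg_left ?_ hL0)
    have h1 := abs_max_sub_max_le_abs (min 1 x) (min 1 y) 0
    have h2 := abs_min_sub_min_le_max 1 x 1 y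
    rw [max_comm 0, max_comm 0 (min 1 y)]
    refine h1.trans (h2.trans ?_)
    simp
  have hbd : ∀ t y, |F t y| ≤ L := by
    intro t y
    have h1 := abs_sub_le_of_hasDerivAt_Icc (hf _ (hmem T t hT)) (hL _ (hmem T t hT))
      (hmem 1 y zero_le_one) (left_mem_Icc.2 zero_le_one)
    rw [(hb _ (hmem T t hT)).1, sub_zero, sub_zero, abs_of_nonneg (hmem 1 y zero_le_one).1] at h1
    exact h1.trans (mul_le_of_le_one_right hL0 (hmem 1 y zero_le_one).2)
  have hFc : ∀ y, Continuous (F · y) := fun y =>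
    hcf.comp_continuous (f := fun t => (max 0 (min T t), max 0 (min 1 y))) (by fun_prop)
      fun t => ⟨hmem T t hT, hmem 1 y zero_le_one⟩
  choose γ hγ0 hγc hγd using exists_trajectory hT hL0 hL0 hFc hlip hbd
  have hF0 : ∀ t ∈ Ioo 0 T, F t 0 = 0 := fun t ht => by
    rw [hFeq t 0 (Ioo_subset_Icc_self ht) (by simp)]; exact (hb t (Ioo_subset_Icc_self ht)).1
  have hF1 : ∀ t ∈ Ioo 0 T, F t 1 = 0 := fun t ht => by
    rw [hFeq t 1 (Ioo_subset_Icc_self ht) (by simp)]; exact (hb t (Ioo_subset_Icc_self ht)).2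
  have hd0 : ∀ t ∈ Ioo 0 T, HasDerivAt (fun _ : ℝ => (0:ℝ)) (F t 0) t := fun t ht => by
    rw [hF0 t ht]; exact hasDerivAt_const t 0
  have hd1 : ∀ t ∈ Ioo 0 T, HasDerivAt (fun _ : ℝ => (1:ℝ)) (F t 1) t := fun t ht => by
    rw [hF1 t ht]; exact hasDerivAt_const t 1
  have hleft : ∀ t ∈ Icc 0 T, γ 0 t = 0 := fun t ht => by
    have := (sq_sub_bounds (hγc 0) continuousOn_const (hγd 0) hd0 (fun s _ => hlip s _ _) ht).1
    rw [hγ0] at this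
    nlinarith
  have hright : ∀ t ∈ Icc 0 T, γ 1 t = 1 := fun t ht => by
    have := (sq_sub_bounds (hγc 1) continuousOn_const (hγd 1) hd1 (fun s _ => hlip s _ _) ht).1
    rw [hγ0] at this
    nlinarith
  have hIoo : ∀ x ∈ Ioo (0:ℝ) 1, ∀ t ∈ Icc 0 T, γ x t ∈ Ioo (0:ℝ) 1 := fun x hx t ht =>
    ⟨trajectory_lt (hγc x) continuousOn_const (hγd x) hd0 (fun s _ => hlip s _ _)
      (by simpa [hγ0] using hx.1) ht,
    trajectory_lt continuousOn_const (hγc x) hd1 (hγd x) (fun s _ => hlip s _ _)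
      (by simpa [hγ0] using hx.2) ht⟩
  refine ⟨γ, fun x _ => hγ0 x, fun x _ => hγc x, fun x hx t ht => ?_, hIoo, hleft, hright⟩
  have ht' := Ioo_subset_Icc_self ht
  have hmemγ : γ x t ∈ Icc (0:ℝ) 1 := by
    rcases hx.1.eq_or_lt with rfl | h0
    · simp [hleft t ht']
    rcases hx.2.eq_or_lt with rfl | h1
    · simp [hright t ht']
    exact Ioo_subset_Icc_self (hIoo x ⟨h0, h1⟩ t ht')
  rw [← hFeq t _ ht' hmemγ]
  exact hγd x t ht

lemma IsFlow.continuousOn_label {T L : ℝ} {f fx γ : ℝ → ℝ → ℝ} (h : IsFlow T f γ)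
    (hf : ∀ t ∈ Icc (0:ℝ) T, ∀ x ∈ Icc (0:ℝ) 1, HasDerivAt (f t) (fx t x) x)
    (hL : ∀ t ∈ Icc (0:ℝ) T, ∀ x ∈ Icc (0:ℝ) 1, |fx t x| ≤ L) {t : ℝ} (ht : t ∈ Icc 0 T) :
    ContinuousOn (fun x => γ x t) (Icc 0 1) := by
  intro x hx
  have hb : ∀ y ∈ Icc (0:ℝ) 1, |γ y t - γ x t| ≤ √(Real.exp (2 * L * t) * (y - x) ^ 2) := by
    intro y hy
    have := (sq_sub_bounds (h.cont y hy) (h.cont x hx) (h.deriv y hy) (h.deriv x hx)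
      (fun s hs => abs_sub_le_of_hasDerivAt_Icc (hf s (Ioo_subset_Icc_self hs))
        (hL s (Ioo_subset_Icc_self hs)) (h.mem_Icc hy (Ioo_subset_Icc_self hs))
        (h.mem_Icc hx (Ioo_subset_Icc_self hs))) ht).1
    rw [h.initial y hy, h.initial x hx] at this
    exact Real.abs_le_sqrt this
  refine tendsto_iff_dist_tendsto_zero.2 (squeeze_zero' (Filter.Eventually.of_forall
    fun _ => dist_nonneg) (Filter.eventually_of_mem self_mem_nhdsWithin hb) ?_)
  have : Continuous fun y => √(Real.exp (2 * L * t) * (y - x) ^ 2) := by fun_prop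
  simpa using (this.tendsto x).mono_left nhdsWithin_le_nhds

/-- The Jacobian of the flow is the exponential of the primitive of `fx` along trajectories. -/
lemma IsFlow.hasDerivAt_label {T : ℝ} {f fx γ : ℝ → ℝ → ℝ} (h : IsFlow T f γ)
    (hf : ∀ t ∈ Icc (0:ℝ) T, ∀ x ∈ Icc (0:ℝ) 1, HasDerivAt (f t) (fx t x) x)
    (hcfx : ContinuousOn (fun p : ℝ × ℝ => fx p.1 p.2) (Icc (0:ℝ) T ×ˢ Icc (0:ℝ) 1))
    {x : ℝ} (hx : x ∈ Ioo (0:ℝ) 1) {P : ℝ → ℝ} (hPc : ContinuousOn P (Icc 0 T)) (hP0 : P 0 = 0)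
    (hP : ∀ t ∈ Ioo 0 T, HasDerivAt P (fx t (γ x t)) t) {t : ℝ} (ht : t ∈ Icc 0 T) :
    HasDerivAt (fun y => γ y t) (Real.exp (P t)) x := by
  have hcomp : IsCompact (Icc (0:ℝ) T ×ˢ Icc (0:ℝ) 1) := isCompact_Icc.prod isCompact_Icc
  obtain ⟨L, hL⟩ := hcomp.exists_bound_of_continuousOn hcfx
  have hL : ∀ s ∈ Icc (0:ℝ) T, ∀ y ∈ Icc (0:ℝ) 1, |fx s y| ≤ L := fun s hs y hy =>
    hL (s, y) ⟨hs, hy⟩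
  have hT : 0 ≤ T := ht.1.trans ht.2
  have hx' := Ioo_subset_Icc_self hx
  have hL0 : 0 ≤ L := (abs_nonneg _).trans (hL 0 ⟨le_rfl, hT⟩ x hx')
  have hlip : ∀ y ∈ Icc (0:ℝ) 1, ∀ s ∈ Ioo 0 T,
      |f s (γ y s) - f s (γ x s)| ≤ L * |γ y s - γ x s| := fun y hy s hs =>
    abs_sub_le_of_hasDerivAt_Icc (hf s (Ioo_subset_Icc_self hs))
        (hL s (Ioo_subset_Icc_self hs)) (h.mem_Icc hy (Ioo_subset_Icc_self hs))
        (h.mem_Icc hx' (Ioo_subset_Icc_self hs))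
  have hlog : ∀ ε > 0, ∃ r > 0, ∀ y ∈ Ioo (0:ℝ) 1, y ≠ x → |y - x| < r →
      0 < slope (fun y => γ y t) x y ∧
      |Real.log (slope (fun y => γ y t) x y) - P t| ≤ ε * t := by
    intro ε hε
    obtain ⟨δ, hδ, hunif⟩ := Metric.uniformContinuousOn_iff_le.1
      (hcomp.uniformContinuousOn_of_continuous hcfx) ε hε
    refine ⟨δ / Real.exp (L * T), by positivity, fun y hy hyx hyr => ?_⟩
    have hy' := Ioo_subset_Icc_self hy
    have hyx0 : y - x ≠ 0 := sub_ne_zero.2 hyx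
    set k : ℝ → ℝ := fun s => slope (fun y => γ y s) x y with hk
    have hkdef (s : ℝ) : k s = (γ y s - γ x s) / (y - x) := by
      simp only [hk, slope_def_field]
    have hkc : ContinuousOn k (Icc 0 T) := by
      simp only [funext hkdef]
      exact ((h.cont y hy').sub (h.cont x hx')).div_const _
    have hk0 : k 0 = 1 := by
      rw [hkdef, h.initial y hy', h.initial x hx', div_self hyx0]
    have hbounds {s : ℝ} (hs : s ∈ Icc 0 T) := sq_sub_bounds (h.cont y hy') (h.cont x hx')
      (h.deriv y hy') (h.deriv x hx') (hlip y hy') hs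
    have hne : ∀ s ∈ Icc 0 T, γ y s - γ x s ≠ 0 := fun s hs h0 => by
      have := (hbounds hs).2
      rw [h.initial y hy', h.initial x hx', h0] at this
      have := pow_pos (abs_pos.2 hyx0) 2
      rw [sq_abs] at this
      linarith
    have hkpos {s : ℝ} (hs : s ∈ Icc 0 T) : 0 < k s :=
      pos_of_continuousOn_of_ne_zero hkc (by simp [hk0])
        (fun s hs => by rw [hkdef]; exact div_ne_zero (hne s hs) hyx0) hs
    have hclose : ∀ s ∈ Icc 0 T, |γ y s - γ x s| ≤ δ := by
      intro s hs
      have h1 := (hbounds hs).1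
      rw [h.initial y hy', h.initial x hx'] at h1
      have h2 : Real.exp (2 * L * s) * (y - x) ^ 2 = (Real.exp (L * s) * |y - x|) ^ 2 := by
        rw [mul_pow, sq_abs, ← Real.exp_nat_mul]; push_cast; ring_nf
      rw [h2] at h1
      have h3 := abs_le_of_sq_le_sq h1 (by positivity)
      have h4 : Real.exp (L * s) ≤ Real.exp (L * T) :=
        Real.exp_le_exp.2 (mul_le_mul_of_nonneg_left hs.2 hL0)
      calc |γ y s - γ x s| ≤ Real.exp (L * s) * |y - x| := h3
        _ ≤ Real.exp (L * T) * (δ / Real.exp (L * T)) := by gcongr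
        _ = δ := by field_simp
    have hlogd : ∀ s ∈ Ioo 0 T, ∃ w, |w - fx s (γ x s)| ≤ ε ∧
        HasDerivAt (fun s => Real.log (k s)) w s := by
      intro s hs
      have hs' := Ioo_subset_Icc_self hs
      have hyI := h.mem_Icc hy' hs'
      have hxI := h.mem_Icc hx' hs'
      refine ⟨(f s (γ y s) - f s (γ x s)) / (γ y s - γ x s), ?_, ?_⟩
      · have hsub : uIcc (γ x s) (γ y s) ⊆ Icc 0 1 := (convex_Icc (0:ℝ) 1).ordConnected.uIcc_subset
          hxI hyI
        have := (convex_uIcc (γ x s) (γ y s)).norm_image_sub_le_of_norm_hasDerivWithin_le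
          (f := fun z => f s z - fx s (γ x s) * z) (f' := fun z => fx s z - fx s (γ x s)) (C := ε)
          (fun z hz => (((hf s hs' z (hsub hz)).sub
            (((hasDerivAt_id z).const_mul (fx s (γ x s))).congr_deriv (mul_one _)))).hasDerivWithinAt)
          (fun z hz => by
            refine hunif (s, z) ⟨hs', hsub hz⟩ (s, γ x s) ⟨hs', hxI⟩ ?_
            rw [Prod.dist_eq, dist_self, Real.dist_eq]
            refine max_le hδ.le ?_
            exact (abs_sub_left_of_mem_uIcc hz).trans (hclose s hs'))
          left_mem_uIcc right_mem_uIcc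
        rw [Real.norm_eq_abs, Real.norm_eq_abs] at this
        have e : (f s (γ y s) - f s (γ x s)) / (γ y s - γ x s) - fx s (γ x s)
            = (f s (γ y s) - fx s (γ x s) * γ y s - (f s (γ x s) - fx s (γ x s) * γ x s))
              / (γ y s - γ x s) := by
          field_simp [hne s hs']; ring
        rw [e, abs_div, div_le_iff₀ (abs_pos.2 (hne s hs'))]
        exact this
      · have h1 : HasDerivAt k ((f s (γ y s) - f s (γ x s)) / (y - x)) s := by
          rw [funext hkdef]
          exact ((h.deriv y hy' s hs).sub (h.deriv x hx' s hs)).div_const _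
        convert h1.log (hkpos hs').ne' using 1
        rw [hkdef, div_div_div_cancel_right₀ hyx0]
    choose! w hw hwd using hlogd
    have hlogc : ContinuousOn (fun s => Real.log (k s)) (Icc 0 T) :=
      hkc.log fun s hs => (hkpos hs).ne'
    refine ⟨hkpos ht, abs_le.2 ⟨?_, ?_⟩⟩
    · have := le_of_hasDerivAt_nonneg (g := fun s => Real.log (k s) - P s + ε * s)
        (g' := fun s => w s - fx s (γ x s) + ε) (by fun_prop)
        (fun s hs => ((hwd s hs).sub (hP s hs)).add
          (((hasDerivAt_id s).const_mul ε).congr_deriv (mul_one _)))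
        (fun s hs => by linarith [(abs_le.1 (hw s hs)).1]) ht
      simp only [hk0, Real.log_one, hP0, mul_zero] at this
      simp only [hk] at this
      linarith
    · have := le_of_hasDerivAt_nonneg (g := fun s => ε * s - (Real.log (k s) - P s))
        (g' := fun s => ε - (w s - fx s (γ x s))) (by fun_prop)
        (fun s hs => (((hasDerivAt_id s).const_mul ε).congr_deriv (mul_one _)).sub
          ((hwd s hs).sub (hP s hs)))
        (fun s hs => by linarith [(abs_le.1 (hw s hs)).2]) ht
      simp only [hk0, Real.log_one, hP0, mul_zero] at this
      simp only [hk] at this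
      linarith
  rw [hasDerivAt_iff_tendsto_slope]
  have hev (r : ℝ) (hr : 0 < r) : ∀ᶠ y in nhdsWithin x {x}ᶜ,
      y ∈ Ioo (0:ℝ) 1 ∧ y ≠ x ∧ |y - x| < r := by
    filter_upwards [self_mem_nhdsWithin, mem_nhdsWithin_of_mem_nhds (Ioo_mem_nhds hx.1 hx.2),
      mem_nhdsWithin_of_mem_nhds (Metric.ball_mem_nhds x hr)] with y h1 h2 h3
    exact ⟨h2, h1, h3⟩
  have hlim : Filter.Tendsto (fun y => Real.log (slope (fun y => γ y t) x y))
      (nhdsWithin x {x}ᶜ) (nhds (P t)) := by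
    rw [Metric.tendsto_nhds]
    intro ε hε
    obtain ⟨r, hr, hr'⟩ := hlog (ε / (t + 1)) (div_pos hε (by linarith [ht.1]))
    filter_upwards [hev r hr] with y hy
    refine ((hr' y hy.1 hy.2.1 hy.2.2).2).trans_lt ?_
    have : 0 < t + 1 := by linarith [ht.1]
    rw [div_mul_eq_mul_div, div_lt_iff₀ this]
    linarith
  obtain ⟨r, hr, hr'⟩ := hlog 1 one_pos
  refine ((Real.continuous_exp.tendsto _).comp hlim).congr' ?_
  filter_upwards [hev r hr] with y hy
  exact Real.exp_log (hr' y hy.1 hy.2.1 hy.2.2).1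

lemma hasDerivAt_along_curve {T : ℝ} {g gt gx : ℝ → ℝ → ℝ}
    (hgt : ∀ t ∈ Ico (0:ℝ) T, ∀ x ∈ Icc (0:ℝ) 1, HasDerivAt (fun s => g s x) (gt t x) t)
    (hgx : ∀ t ∈ Ico (0:ℝ) T, ∀ x ∈ Icc (0:ℝ) 1, HasDerivAt (g t) (gx t x) x)
    (hct : ContinuousOn (fun p : ℝ × ℝ => gt p.1 p.2) (Ico (0:ℝ) T ×ˢ Icc (0:ℝ) 1))
    (hcx : ContinuousOn (fun p : ℝ × ℝ => gx p.1 p.2) (Ico (0:ℝ) T ×ˢ Icc (0:ℝ) 1))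
    {u : ℝ → ℝ} {u' t : ℝ} (ht : t ∈ Ioo 0 T) (hut : u t ∈ Ioo (0:ℝ) 1) (hu : HasDerivAt u u' t) :
    HasDerivAt (fun s => g s (u s)) (gt t (u t) + gx t (u t) * u') t := by
  have hmem : Ico (0:ℝ) T ×ˢ Icc (0:ℝ) 1 ∈ nhds (t, u t) :=
    prod_mem_nhds (Ico_mem_nhds ht.1 ht.2) (Icc_mem_nhds hut.1 hut.2)
  have key := hasStrictFDerivAt_uncurry_coprod (𝕜 := ℝ) (u := (t, u t)) (f := g)
    (f₁ := fun s x => ContinuousLinearMap.toSpanSingleton ℝ (gt s x))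
    (f₂ := fun s x => ContinuousLinearMap.toSpanSingleton ℝ (gx s x))
    (by
      filter_upwards [hmem] with v hv
      exact (hgt v.1 hv.1 v.2 hv.2).hasFDerivAt)
    (by
      filter_upwards [hmem] with v hv
      exact (hgx v.1 hv.1 v.2 hv.2).hasFDerivAt)
    ((ContinuousLinearMap.toSpanSingletonCLE (𝕜 := ℝ) (E := ℝ)).continuous.continuousAt.comp
      (hct.continuousAt hmem))
    ((ContinuousLinearMap.toSpanSingletonCLE (𝕜 := ℝ) (E := ℝ)).continuous.continuousAt.comp
      (hcx.continuousAt hmem))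
  have := key.hasFDerivAt.comp_hasDerivAt t ((hasDerivAt_id t).prodMk hu)
  convert! this using 1
  simp [Function.HasUncurry.uncurry, mul_comm]

lemma eventually_mul_le_of_hasDerivAt_zero {h : ℝ → ℝ} {h' : ℝ}
    (hd : HasDerivAt h h' 0) (hnn : ∀ x ∈ Icc (0:ℝ) 1, 0 ≤ h x) (h0 : h 0 = 0) (hne : h' ≠ 0) :
    ∃ c > 0, ∀ᶠ x in nhds (0:ℝ), 0 ≤ x → c * x ≤ h x := by
  have hs := hasDerivAt_iff_tendsto_slope.1 hd
  have hpos : 0 ≤ h' := by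
    refine ge_of_tendsto (hs.mono_left (nhdsGT_le_nhdsNE 0)) ?_
    filter_upwards [Ioo_mem_nhdsGT (zero_lt_one' ℝ)] with x hx
    rw [slope_def_field, h0, sub_zero, sub_zero]
    exact div_nonneg (hnn x (Ioo_subset_Icc_self hx)) hx.1.le
  have hpos : 0 < h' := lt_of_le_of_ne hpos hne.symm
  refine ⟨h' / 2, half_pos hpos, ?_⟩
  filter_upwards [eventually_nhdsWithin_iff.1 (hs.eventually_const_lt (half_lt_self hpos))]
    with x hx hx0
  rcases hx0.eq_or_lt with rfl | hx0
  · simp [h0]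
  have := hx hx0.ne'
  rw [slope_def_field, h0, sub_zero, sub_zero, lt_div_iff₀ hx0] at this
  exact this.le

/-- A nonnegative function on `[0, 1]` with at most simple zeros at the endpoints and no other
zero dominates a multiple of the distance to the boundary. -/
lemma exists_mul_min_le {h h' : ℝ → ℝ} (hd : ∀ x ∈ Icc (0:ℝ) 1, HasDerivAt h (h' x) x)
    (hnn : ∀ x ∈ Icc (0:ℝ) 1, 0 ≤ h x) (hpos : ∀ x ∈ Ioo (0:ℝ) 1, 0 < h x)
    (h0 : h 0 = 0 → h' 0 ≠ 0) (h1 : h 1 = 0 → h' 1 ≠ 0) :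
    ∃ c > 0, ∀ x ∈ Icc (0:ℝ) 1, c * min x (1 - x) ≤ h x := by
  refine isCompact_Icc.induction_on
    (p := fun s => ∃ c > 0, ∀ x ∈ s, x ∈ Icc (0:ℝ) 1 → c * min x (1 - x) ≤ h x)
    ⟨1, one_pos, by simp⟩ ?_ ?_ ?_ |>.imp fun c hc => ⟨hc.1, fun x hx => hc.2 x hx hx⟩
  · rintro s t hst ⟨c, hc, h⟩
    exact ⟨c, hc, fun x hx => h x (hst hx)⟩
  · rintro s t ⟨c, hc, hs⟩ ⟨d, hd, ht⟩
    refine ⟨min c d, lt_min hc hd, fun x hx hxI => ?_⟩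
    have hm : 0 ≤ min x (1 - x) := le_min hxI.1 (by linarith [hxI.2])
    rcases hx with hx | hx
    · exact (mul_le_mul_of_nonneg_right (min_le_left _ _) hm).trans (hs x hx hxI)
    · exact (mul_le_mul_of_nonneg_right (min_le_right _ _) hm).trans (ht x hx hxI)
  · intro x hx
    suffices H : ∃ c > 0, ∀ᶠ y in nhds x, y ∈ Icc (0:ℝ) 1 → c * min y (1 - y) ≤ h y by
      obtain ⟨c, hc, H⟩ := H
      exact ⟨_, mem_nhdsWithin_of_mem_nhds H, c, hc, fun y hy => hy⟩
    rcases (hnn x hx).eq_or_lt with hx0 | hx0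
    · rcases hx.1.eq_or_lt with rfl | hxl
      · obtain ⟨c, hc, H⟩ := eventually_mul_le_of_hasDerivAt_zero (hd 0 hx) hnn hx0.symm
          (h0 hx0.symm)
        refine ⟨c, hc, ?_⟩
        filter_upwards [H] with y hy hyI
        exact (mul_le_mul_of_nonneg_left (min_le_left _ _) hc.le).trans (hy hyI.1)
      rcases hx.2.eq_or_lt with rfl | hxr
      · have hd1 : HasDerivAt (fun y => h (1 - y)) (-h' 1) 0 := by
          have := (show HasDerivAt h (h' 1) (1 - 0) by simpa using hd 1 hx).comp_const_sub 1 0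
          simpa using this
        obtain ⟨c, hc, H⟩ := eventually_mul_le_of_hasDerivAt_zero hd1
          (fun y hy => hnn _ ⟨by linarith [hy.2], by linarith [hy.1]⟩) (by simpa using hx0.symm)
          (neg_ne_zero.2 (h1 hx0.symm))
        have ht : Filter.Tendsto (fun y : ℝ => 1 - y) (nhds 1) (nhds 0) := by
          simpa using (show Continuous fun y : ℝ => 1 - y by fun_prop).tendsto 1
        refine ⟨c, hc, ?_⟩
        filter_upwards [ht.eventually H] with y hy hyI
        refine (mul_le_mul_of_nonneg_left (min_le_right _ _) hc.le).trans ?_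
        simpa using hy (by linarith [hyI.2])
      · exact absurd hx0 (hpos x ⟨hxl, hxr⟩).ne
    · refine ⟨h x / 2, half_pos hx0, ?_⟩
      filter_upwards [(hd x hx).continuousAt.eventually_const_lt (half_lt_self hx0)] with y hy hyI
      refine le_trans ?_ hy.le
      exact mul_le_of_le_one_right (half_pos hx0).le ((min_le_left _ _).trans hyI.2)

lemma one_sub_mul_pos {M μ y : ℝ} (hM : 0 < M) (hμ : μ ∈ Ico 0 (1 / M)) (hy : y ≤ M) :
    0 < 1 - μ * y := by
  have := (lt_div_iff₀ hM).1 hμ.2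
  nlinarith [mul_le_mul_of_nonneg_left hy hμ.1]

lemma continuousOn_integral_inv {g : ℝ → ℝ} {M : ℝ} (hg : ContinuousOn g (Icc 0 1)) (hM : 0 < M)
    (hub : ∀ x ∈ Icc (0:ℝ) 1, g x ≤ M) :
    ContinuousOn (fun μ : ℝ => ∫ x in (0:ℝ)..1, (1 - μ * g x)⁻¹) (Ico 0 (1 / M)) := by
  intro μ₀ hμ₀
  obtain ⟨b, hb, hbM⟩ := exists_between hμ₀.2
  have hbpos : 0 < 1 - b * M := one_sub_mul_pos hM ⟨hμ₀.1.trans hb.le, hbM⟩ le_rfl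
  have hgc : Continuous fun x => g (max 0 (min 1 x)) :=
    hg.comp_continuous (by fun_prop)
      fun s => ⟨le_max_left _ _, max_le zero_le_one (min_le_left _ _)⟩
  have hc : Continuous fun μ : ℝ =>
      ∫ x in (0:ℝ)..1, (max (1 - b * M) (1 - μ * g (max 0 (min 1 x))))⁻¹ := by
    refine intervalIntegral.continuous_parametric_intervalIntegral_of_continuous' ?_ 0 1
    refine Continuous.inv₀ ?_ fun p => (lt_max_of_lt_left hbpos).ne'
    have := hgc.comp (continuous_snd : Continuous (Prod.snd : ℝ × ℝ → ℝ))
    exact continuous_const.max (continuous_const.sub (continuous_fst.mul this))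
  have heq : ∀ μ ∈ Icc 0 b, (∫ x in (0:ℝ)..1, (1 - μ * g x)⁻¹)
      = ∫ x in (0:ℝ)..1, (max (1 - b * M) (1 - μ * g (max 0 (min 1 x))))⁻¹ := by
    intro μ hμ
    refine intervalIntegral.integral_congr fun x hx => ?_
    rw [uIcc_of_le zero_le_one] at hx
    rw [min_eq_right hx.2, max_eq_right hx.1, max_eq_right]
    nlinarith [mul_le_mul_of_nonneg_left (hub x hx) hμ.1, mul_le_mul_of_nonneg_right hμ.2 hM.le]
  refine (hc.continuousAt (x := μ₀)).continuousWithinAt.congr_of_eventuallyEq ?_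
    (heq μ₀ ⟨hμ₀.1, hb.le⟩)
  filter_upwards [self_mem_nhdsWithin, mem_nhdsWithin_of_mem_nhds (Iio_mem_nhds hb)]
    with μ h1 h2
  exact heq μ ⟨h1.1, le_of_lt h2⟩

lemma inv_le_rpow_mul_rpow_s14 {a b y : ℝ} (ha : 0 < a) (hb : 0 < b) (hay : a ≤ y) (hby : b ≤ y) :
    y⁻¹ ≤ a ^ (-(1 / 4) : ℝ) * b ^ (-(3 / 4) : ℝ) := by
  have hy : 0 < y := ha.trans_le hay
  have e : y⁻¹ = y ^ (-(1 / 4) : ℝ) * y ^ (-(3 / 4) : ℝ) := by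
    rw [← Real.rpow_add hy, ← Real.rpow_neg_one]; norm_num
  rw [e]
  exact mul_le_mul (Real.rpow_le_rpow_of_nonpos ha hay (by norm_num))
    (Real.rpow_le_rpow_of_nonpos hb hby (by norm_num)) (by positivity) (by positivity)

lemma intervalIntegrable_sq_integral_inv {g : ℝ → ℝ} {M c : ℝ} (hg : ContinuousOn g (Icc 0 1))
    (hM : 0 < M) (hub : ∀ x ∈ Icc (0:ℝ) 1, g x ≤ M) (hc : 0 < c)
    (hlow : ∀ x ∈ Icc (0:ℝ) 1, c * min x (1 - x) ≤ M - g x) :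
    IntervalIntegrable (fun μ : ℝ => (∫ x in (0:ℝ)..1, (1 - μ * g x)⁻¹) ^ 2)
      volume 0 (1 / M) := by
  have hM' : (0:ℝ) ≤ 1 / M := by positivity
  set c' : ℝ := min 1 (c / M) with hc'
  have hc'pos : 0 < c' := lt_min one_pos (div_pos hc hM)
  set b : ℝ → ℝ := fun x => c' ^ (-(3 / 4) : ℝ) * (x ^ (-(3 / 4) : ℝ) + (1 - x) ^ (-(3 / 4) : ℝ))
  have hr : IntervalIntegrable (fun x : ℝ => x ^ (-(3 / 4) : ℝ)) volume 0 1 :=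
    intervalIntegral.intervalIntegrable_rpow' (by norm_num)
  have hbint : IntervalIntegrable b volume 0 1 := by
    have hr' := (hr.comp_sub_left 1).symm
    simp only [sub_zero, sub_self] at hr'
    exact (hr.add hr').const_mul _
  have hpt : ∀ μ ∈ Ico 0 (1 / M), ∀ x ∈ Ioo (0:ℝ) 1,
      (1 - μ * g x)⁻¹ ≤ (1 - μ * M) ^ (-(1 / 4) : ℝ) * b x := by
    intro μ hμ x hx
    have hx' := Ioo_subset_Icc_self hx
    have hm : 0 < min x (1 - x) := lt_min hx.1 (sub_pos.2 hx.2)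
    have hm1 : min x (1 - x) ≤ 1 := (min_le_left _ _).trans hx.2.le
    have hμM : μ * M ≤ 1 := ((lt_div_iff₀ hM).1 hμ.2).le
    have h1 : 1 - μ * M ≤ 1 - μ * g x := by
      nlinarith [mul_le_mul_of_nonneg_left (hub x hx') hμ.1]
    have h2 : c' * min x (1 - x) ≤ 1 - μ * g x := by
      have e1 : c' * min x (1 - x) ≤ 1 :=
        (mul_le_of_le_one_left hm.le (min_le_left _ _)).trans hm1
      have e2 : c' * min x (1 - x) * M ≤ M - g x := by
        refine le_trans ?_ (hlow x hx')
        have : c' * M ≤ c := by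
          have := min_le_right 1 (c / M)
          rwa [le_div_iff₀ hM] at this
        nlinarith
      nlinarith [mul_le_mul_of_nonneg_left e2 hμ.1, mul_le_mul_of_nonneg_left e1
        (sub_nonneg.2 hμM)]
    refine (inv_le_rpow_mul_rpow_s14 (one_sub_mul_pos hM hμ le_rfl) (mul_pos hc'pos hm) h1 h2).trans
      (mul_le_mul_of_nonneg_left ?_ (Real.rpow_nonneg (sub_nonneg.2 hμM) _))
    rw [Real.mul_rpow hc'pos.le hm.le]
    refine mul_le_mul_of_nonneg_left ?_ (Real.rpow_nonneg hc'pos.le _)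
    have n1 : 0 ≤ x ^ (-(3 / 4) : ℝ) := Real.rpow_nonneg hx.1.le _
    have n2 : 0 ≤ (1 - x) ^ (-(3 / 4) : ℝ) := Real.rpow_nonneg (sub_nonneg.2 hx.2.le) _
    rcases min_choice x (1 - x) with h | h <;> rw [h] <;> linarith
  set A : ℝ := ∫ x in (0:ℝ)..1, b x
  have hKle : ∀ μ ∈ Ico 0 (1 / M),
      (∫ x in (0:ℝ)..1, (1 - μ * g x)⁻¹) ≤ (1 - μ * M) ^ (-(1 / 4) : ℝ) * A := by
    intro μ hμ
    rw [← intervalIntegral.integral_const_mul]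
    refine intervalIntegral.integral_mono_on_of_le_Ioo zero_le_one ?_ (hbint.const_mul _)
      (hpt μ hμ)
    refine ContinuousOn.intervalIntegrable ?_
    rw [uIcc_of_le zero_le_one]
    exact (continuousOn_const.sub (continuousOn_const.mul hg)).inv₀
      fun x hx => (one_sub_mul_pos hM hμ (hub x hx)).ne'
  have hdom : IntervalIntegrable (fun μ : ℝ => (1 - μ * M) ^ (-(1 / 2) : ℝ) * A ^ 2)
      volume 0 (1 / M) := by
    have h1 : IntervalIntegrable (fun x : ℝ => x ^ (-(1 / 2) : ℝ)) volume 0 1 :=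
      intervalIntegral.intervalIntegrable_rpow' (by norm_num)
    have h2 := (h1.comp_sub_left 1).symm.comp_mul_right (c := M)
    simp only [sub_zero, sub_self, zero_div] at h2
    exact h2.mul_const _
  rw [intervalIntegrable_iff_integrableOn_Ioo_of_le hM'] at hdom ⊢
  refine Integrable.mono' hdom ?_ ?_
  · exact (((continuousOn_integral_inv hg hM hub).pow 2).mono
      Ioo_subset_Ico_self).aestronglyMeasurable measurableSet_Ioo
  · refine (ae_restrict_iff' measurableSet_Ioo).2 (Filter.Eventually.of_forall fun μ hμ => ?_)
    have hμ' := Ioo_subset_Ico_self hμ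
    have hε := one_sub_mul_pos hM hμ' le_rfl
    have hK0 : 0 ≤ ∫ x in (0:ℝ)..1, (1 - μ * g x)⁻¹ :=
      intervalIntegral.integral_nonneg zero_le_one fun x hx =>
        (inv_pos.2 (one_sub_mul_pos hM hμ' (hub x hx))).le
    rw [Real.norm_of_nonneg (sq_nonneg _)]
    have e : (1 - μ * M) ^ (-(1 / 2) : ℝ) = ((1 - μ * M) ^ (-(1 / 4) : ℝ)) ^ 2 := by
      rw [← Real.rpow_mul_natCast hε.le]; norm_num
    rw [e, ← mul_pow]
    exact pow_le_pow_left₀ hK0 (hKle μ hμ') 2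

lemma le_integral_of_one_le_mul_deriv {T b : ℝ} (hT : 0 ≤ T) {φ η η' : ℝ → ℝ}
    (hφc : ContinuousOn φ (Ico 0 b)) (hφ0 : ∀ x, 0 ≤ φ x) (hφi : IntervalIntegrable φ volume 0 b)
    (hηc : ContinuousOn η (Icc 0 T)) (hη0 : η 0 = 0) (hηb : ∀ t ∈ Icc 0 T, η t ∈ Ico 0 b)
    (hηpos : ∀ t ∈ Ioo 0 T, 0 < η t) (hη : ∀ t ∈ Ioo 0 T, HasDerivAt η (η' t) t)
    (h1 : ∀ t ∈ Ioo 0 T, 1 ≤ φ (η t) * η' t) : T ≤ ∫ x in (0:ℝ)..b, φ x := by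
  have hTT : T ∈ Icc 0 T := ⟨hT, le_rfl⟩
  have hb : 0 ≤ b := (hηb T hTT).1.trans (hηb T hTT).2.le
  have hprim : ContinuousOn (fun y => ∫ x in (0:ℝ)..y, φ x) (Icc 0 b) := by
    rw [← uIcc_of_le hb]
    exact intervalIntegral.continuousOn_primitive_interval' hφi left_mem_uIcc
  have hsub {y : ℝ} (hy : y ∈ Icc 0 b) : IntervalIntegrable φ volume 0 y :=
    hφi.mono_set (by
      rw [uIcc_of_le hb, uIcc_of_le hy.1]; exact Icc_subset_Icc_right hy.2)
  have key := le_of_hasDerivAt_nonneg (g := fun t => (∫ x in (0:ℝ)..η t, φ x) - t)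
    (g' := fun t => φ (η t) * η' t - 1)
    ((hprim.comp hηc fun t ht => Ico_subset_Icc_self (hηb t ht)).sub continuousOn_id)
    (fun t ht => by
      have hmem : η t ∈ Ioo 0 b := ⟨hηpos t ht, (hηb t (Ioo_subset_Icc_self ht)).2⟩
      have hc := hφc.mono Ioo_subset_Ico_self
      have hd := intervalIntegral.integral_hasDerivAt_right (hsub (Ioo_subset_Icc_self hmem))
        (hc.stronglyMeasurableAtFilter isOpen_Ioo _ hmem)
        (hc.continuousAt (Ioo_mem_nhds hmem.1 hmem.2))
      exact (hd.comp t (hη t ht)).sub (hasDerivAt_id t))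
    (fun t ht => sub_nonneg.2 (h1 t ht)) hTT
  simp only [hη0, intervalIntegral.integral_same, sub_zero] at key
  have hmono : ∫ x in (0:ℝ)..η T, φ x ≤ ∫ x in (0:ℝ)..b, φ x :=
    intervalIntegral.integral_mono_interval le_rfl (hηb T hTT).1 (hηb T hTT).2.le
      (Filter.Eventually.of_forall hφ0) hφi
  linarith

lemma IsClassicalSol.hasDerivAt_fx_boundary {T : ℝ} {f ρ fx fxx fxt ρt ρx : ℝ → ℝ → ℝ}
    (hs : IsClassicalSol T f ρ fx fxx fxt ρt ρx) {a : ℝ} (ha : a = 0 ∨ a = 1) {t : ℝ}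
    (ht : t ∈ Ico 0 T) :
    HasDerivAt (fun s => fx s a) (fx t a ^ 2 +
      ((∫ y in (0:ℝ)..1, ρ t y) - 2 * ∫ y in (0:ℝ)..1, (fx t y) ^ 2)) t := by
  have haI : a ∈ Icc (0:ℝ) 1 := by rcases ha with rfl | rfl <;> simp
  have hf : f t a = 0 := by
    rcases ha with rfl | rfl
    exacts [(hs.hbcf t ht).1, (hs.hbcf t ht).2]
  have hρ : ρ t a = 0 := by
    rcases ha with rfl | rfl
    exacts [(hs.hbcρ t ht).1, (hs.hbcρ t ht).2]
  have e := hs.hpde1 t ht a haI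
  rw [hf, hρ] at e
  refine (hs.hfxt t ht a haI).congr_deriv ?_
  rw [← e]; ring

/-- Upper bound for the Jacobian of the flow of a classical solution in terms of the boundary
trajectory at `a`. -/
lemma IsClassicalSol.jacobian_le {T τ : ℝ} {f ρ fx fxx fxt ρt ρx γ : ℝ → ℝ → ℝ}
    (hs : IsClassicalSol T f ρ fx fxx fxt ρt ρx) (hτ : τ < T)
    (hγ : IsFlow τ f γ) (hρ0 : ∀ x ∈ Icc (0:ℝ) 1, 0 ≤ ρ 0 x) {a : ℝ} (ha : a = 0 ∨ a = 1)
    {p q : ℝ → ℝ} (hpc : ContinuousOn p (Icc 0 τ)) (hqc : ContinuousOn q (Icc 0 τ))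
    (hp : ∀ t ∈ Ioo 0 τ, HasDerivAt p (fx t a) t)
    (hq : ∀ t ∈ Ioo 0 τ, HasDerivAt q (Real.exp (2 * p t)) t) (hp0 : p 0 = 0) (hq0 : q 0 = 0)
    {t : ℝ} (ht : t ∈ Icc 0 τ) {x : ℝ} (hx : x ∈ Ioo (0:ℝ) 1) :
    ∃ J : ℝ, HasDerivAt (fun y => γ y t) J x ∧ 0 < J ∧
      Real.exp (-p t) * (1 + (fx 0 a - fx 0 x) * q t) ≤ J⁻¹ := by
  have hIcc : Icc (0:ℝ) τ ⊆ Ico 0 T := fun s hs => ⟨hs.1, hs.2.trans_lt hτ⟩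
  have hIoo : Ioo (0:ℝ) τ ⊆ Ioo 0 T := Ioo_subset_Ioo_right hτ.le
  have haI : a ∈ Icc (0:ℝ) 1 := by rcases ha with rfl | rfl <;> simp
  have hx' := Ioo_subset_Icc_self hx
  have hτ0 : 0 ≤ τ := ht.1.trans ht.2
  have along {g : ℝ → ℝ → ℝ} (hg : ContinuousOn (fun p : ℝ × ℝ => g p.1 p.2)
      (Ico (0:ℝ) T ×ˢ Icc (0:ℝ) 1)) : ContinuousOn (fun s => g s (γ x s)) (Icc 0 τ) :=
    hg.comp (continuousOn_id.prodMk (hγ.cont x hx')) fun s hs => ⟨hIcc hs, hγ.mem_Icc hx' hs⟩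
  have hdc : ContinuousOn (fun s => fx s a) (Icc 0 τ) := fun s hs' =>
    (hs.hfxt s (hIcc hs') a haI).continuousAt.continuousWithinAt
  obtain ⟨P, hP0, hPc, hP⟩ := exists_primitive_Icc hτ0 (along hs.hcfx)
  refine ⟨Real.exp (P t), hγ.hasDerivAt_label (fun s hs' => hs.hfx s (hIcc hs'))
    (hs.hcfx.mono (prod_mono hIcc subset_rfl)) hx hPc hP0 hP ht, Real.exp_pos _, ?_⟩
  rw [← Real.exp_neg]
  have h0 : γ x 0 = x := hγ.initial x hx'
  have key := riccati_comparison (d := fun s => fx s a) (D := fun s => fx s (γ x s))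
    (R := fun s => ρ s (γ x s))
    (J := fun s => (∫ y in (0:ℝ)..1, ρ s y) - 2 * ∫ y in (0:ℝ)..1, (fx s y) ^ 2)
    hdc (along hs.hcfx) (along hs.hcρ) hPc hpc hqc
    (fun s hs' => hs.hasDerivAt_fx_boundary ha (hIcc (Ioo_subset_Icc_self hs')))
    (fun s hs' => by
      have hsI := Ioo_subset_Icc_self hs'
      refine (hasDerivAt_along_curve hs.hfxt hs.hfxx hs.hcfxt hs.hcfxx (hIoo hs')
        (hγ.mem_Ioo x hx s hsI) (hγ.deriv x hx' s hs')).congr_deriv ?_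
      rw [← hs.hpde1 s (hIcc hsI) _ (hγ.mem_Icc hx' hsI)]
      ring)
    (fun s hs' => by
      have hsI := Ioo_subset_Icc_self hs'
      refine (hasDerivAt_along_curve hs.hρt hs.hρx hs.hcρt hs.hcρx (hIoo hs')
        (hγ.mem_Ioo x hx s hsI) (hγ.deriv x hx' s hs')).congr_deriv ?_
      rw [← hs.hpde2 s (hIcc hsI) _ (hγ.mem_Icc hx' hsI)]
      ring)
    hP hp hq hP0 hp0 hq0 (by simpa [h0] using hρ0 x hx') ht
  simpa only [h0] using key

/-- A classical solution on `[0, T)` whose slope `fx 0` is maximal at a boundary point `a`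
satisfies the lifespan bound. -/
lemma IsClassicalSol.time_le {T τ M : ℝ} {f ρ fx fxx fxt ρt ρx : ℝ → ℝ → ℝ}
    (hs : IsClassicalSol T f ρ fx fxx fxt ρt ρx) (hτ0 : 0 ≤ τ) (hτ : τ < T)
    (hρ0 : ∀ x ∈ Icc (0:ℝ) 1, 0 ≤ ρ 0 x) {a : ℝ} (ha : a = 0 ∨ a = 1) (hM : 0 < M)
    (haM : fx 0 a = M) (hub : ∀ x ∈ Icc (0:ℝ) 1, fx 0 x ≤ M)
    (hint : IntervalIntegrable (fun μ : ℝ => (∫ x in (0:ℝ)..1, (1 - μ * fx 0 x)⁻¹) ^ 2)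
      volume 0 (1 / M)) :
    τ ≤ ∫ μ in (0:ℝ)..(1 / M), (∫ x in (0:ℝ)..1, (1 - μ * fx 0 x)⁻¹) ^ 2 := by
  have hIcc : Icc (0:ℝ) τ ⊆ Ico 0 T := fun s hs => ⟨hs.1, hs.2.trans_lt hτ⟩
  have haI : a ∈ Icc (0:ℝ) 1 := by rcases ha with rfl | rfl <;> simp
  have hf : ∀ t ∈ Icc (0:ℝ) τ, ∀ x ∈ Icc (0:ℝ) 1, HasDerivAt (f t) (fx t x) x :=
    fun s hs' => hs.hfx s (hIcc hs')
  have hcfx := hs.hcfx.mono (prod_mono hIcc (subset_refl (Icc (0:ℝ) 1)))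
  obtain ⟨L, hL⟩ := (isCompact_Icc.prod isCompact_Icc).exists_bound_of_continuousOn hcfx
  have hL : ∀ s ∈ Icc (0:ℝ) τ, ∀ y ∈ Icc (0:ℝ) 1, |fx s y| ≤ L := fun s hs y hy =>
    hL (s, y) ⟨hs, hy⟩
  obtain ⟨γ, hγ⟩ := exists_isFlow hτ0 hf (hs.hcf.mono (prod_mono hIcc subset_rfl)) hL
    fun t ht => hs.hbcf t (hIcc ht)
  have hdc : ContinuousOn (fun s => fx s a) (Icc 0 τ) := fun s hs' =>
    (hs.hfxt s (hIcc hs') a haI).continuousAt.continuousWithinAt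
  obtain ⟨p, hp0, hpc, hp⟩ := exists_primitive_Icc hτ0 hdc
  obtain ⟨q, hq0, hqc, hq⟩ := exists_primitive_Icc hτ0
    (g := fun t => Real.exp (2 * p t)) (by fun_prop)
  have hqmono : StrictMonoOn q (Icc 0 τ) := by
    refine strictMonoOn_of_hasDerivWithinAt_pos (f' := fun t => Real.exp (2 * p t))
      (convex_Icc 0 τ) hqc ?_ fun _ _ => Real.exp_pos _
    rw [interior_Icc]
    exact fun t ht => (hq t ht).hasDerivWithinAt
  have h0I : (0:ℝ) ∈ Icc 0 τ := ⟨le_rfl, hτ0⟩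
  have hqnn : ∀ t ∈ Icc 0 τ, 0 ≤ q t := fun t ht => by
    rw [← hq0]; exact hqmono.monotoneOn h0I ht ht.1
  have hqpos : ∀ t ∈ Ioo 0 τ, 0 < q t := fun t ht => by
    rw [← hq0]; exact hqmono h0I (Ioo_subset_Icc_self ht) ht.1
  have hden : ∀ t ∈ Icc 0 τ, 0 < 1 + M * q t := fun t ht => by
    have := mul_nonneg hM.le (hqnn t ht); linarith
  have hgc : ContinuousOn (fx 0) (Icc 0 1) := fun x hx =>
    (hs.hfxx 0 (hIcc h0I) x hx).continuousAt.continuousWithinAt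
  have hη : ∀ t ∈ Icc 0 τ, q t / (1 + M * q t) ∈ Ico 0 (1 / M) := fun t ht => by
    refine ⟨div_nonneg (hqnn t ht) (hden t ht).le, ?_⟩
    rw [div_lt_div_iff₀ (hden t ht) hM]
    linarith
  set K : ℝ → ℝ := fun μ => ∫ x in (0:ℝ)..1, (1 - μ * fx 0 x)⁻¹ with hK
  have hKge : ∀ t ∈ Icc 0 τ, Real.exp (-p t) * (1 + M * q t) ≤ K (q t / (1 + M * q t)) := by
    intro t ht
    have hcpos : 0 < Real.exp (-p t) * (1 + M * q t) := mul_pos (Real.exp_pos _) (hden t ht)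
    have hfac (x : ℝ) : Real.exp (-p t) * (1 + (fx 0 a - fx 0 x) * q t)
        = Real.exp (-p t) * (1 + M * q t) * (1 - q t / (1 + M * q t) * fx 0 x) := by
      rw [haM]; field_simp [(hden t ht).ne']; ring
    have hJ := fun x (hx : x ∈ Ioo (0:ℝ) 1) =>
      hs.jacobian_le hτ hγ hρ0 ha hpc hqc hp hq hp0 hq0 ht hx
    choose! J hJd hJpos hJle using hJ
    have hφc : ContinuousOn (fun x => (Real.exp (-p t) * (1 + M * q t))⁻¹ *
        (1 - q t / (1 + M * q t) * fx 0 x)⁻¹) (Icc 0 1) :=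
      continuousOn_const.mul ((continuousOn_const.sub (continuousOn_const.mul hgc)).inv₀
        fun x hx => (one_sub_mul_pos hM (hη t ht) (hub x hx)).ne')
    have key := intervalIntegral.sub_le_integral_of_hasDeriv_right_of_le (zero_le_one' ℝ)
      (hγ.continuousOn_label hf hL ht) (fun x hx => (hJd x hx).hasDerivWithinAt)
      hφc.integrableOn_Icc (fun x hx => by
        rw [← mul_inv, ← hfac]
        refine (le_inv_comm₀ ?_ (hJpos x hx)).1 (hJle x hx)
        rw [hfac]
        exact mul_pos hcpos (one_sub_mul_pos hM (hη t ht) (hub x (Ioo_subset_Icc_self hx))))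
    rw [hγ.left t ht, hγ.right t ht, intervalIntegral.integral_const_mul, sub_zero,
      le_inv_mul_iff₀ hcpos, mul_one] at key
    exact key
  refine le_integral_of_one_le_mul_deriv (η := fun t => q t / (1 + M * q t))
    (η' := fun t => Real.exp (2 * p t) / (1 + M * q t) ^ 2) hτ0
    ((continuousOn_integral_inv hgc hM hub).pow 2) (fun _ => sq_nonneg _) hint
    (hqc.div (continuousOn_const.add (continuousOn_const.mul hqc)) fun t ht => (hden t ht).ne')
    (by simp [hq0]) hη
    (fun t ht => div_pos (hqpos t ht) (hden t (Ioo_subset_Icc_self ht))) (fun t ht => ?_)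
    (fun t ht => ?_)
  · refine ((hq t ht).div (((hq t ht).const_mul M).const_add 1)
      (hden t (Ioo_subset_Icc_self ht)).ne').congr_deriv ?_
    ring
  · have ht' := Ioo_subset_Icc_self ht
    have hd := hden t ht'
    have hsq := pow_le_pow_left₀ (mul_pos (Real.exp_pos _) hd).le (hKge t ht') 2
    have e : Real.exp (2 * p t) / (1 + M * q t) ^ 2
        = ((Real.exp (-p t) * (1 + M * q t)) ^ 2)⁻¹ := by
      rw [mul_pow, mul_inv, ← Real.exp_nat_mul, ← Real.exp_neg, div_eq_mul_inv]
      push_cast; ring_nf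
    rw [e, ← div_eq_mul_inv, one_le_div (by positivity)]
    exact hsq

/-- (Theorem 3.2: finite-time blowup.) For smooth nontrivial `f₀` with
Dirichlet data, nonnegative `ρ₀` vanishing at the boundary, `M₀ = max f₀' > 0` attained
only at boundary points where `f₀'' ≠ 0`, the bound
`B = ∫₀^{1/M₀} (∫₀¹ (1 - μ f₀'(x))⁻¹ dx)² dμ` is finite and every classical solution of
the reduced Boussinesq system on `[0,T) × [0,1]` with initial data `(f₀, ρ₀)` satisfies
`T ≤ B`; in particular no global classical solution exists. -/
theorem stmt14 (f₀ ρ₀ f₀d f₀dd : ℝ → ℝ)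
    (hf₀smooth : ContDiffOn ℝ (⊤ : ℕ∞) f₀ (Icc (0:ℝ) 1))
    (hρ₀smooth : ContDiffOn ℝ (⊤ : ℕ∞) ρ₀ (Icc (0:ℝ) 1))
    (hf₀d : ∀ x ∈ Icc (0:ℝ) 1, HasDerivAt f₀ (f₀d x) x)
    (hf₀dd : ∀ x ∈ Icc (0:ℝ) 1, HasDerivAt f₀d (f₀dd x) x)
    (hne : ∃ x ∈ Icc (0:ℝ) 1, f₀ x ≠ 0)
    (hbcf₀ : f₀ 0 = 0 ∧ f₀ 1 = 0) (hbcρ₀ : ρ₀ 0 = 0 ∧ ρ₀ 1 = 0)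
    (hρ₀pos : ∀ x ∈ Icc (0:ℝ) 1, 0 ≤ ρ₀ x)
    (M₀ : ℝ) (hM₀pos : 0 < M₀)
    (hub : ∀ x ∈ Icc (0:ℝ) 1, f₀d x ≤ M₀)
    (hatt : f₀d 0 = M₀ ∨ f₀d 1 = M₀)
    (honly : ∀ x ∈ Ioo (0:ℝ) 1, f₀d x < M₀)
    (hvort0 : f₀d 0 = M₀ → f₀dd 0 ≠ 0)
    (hvort1 : f₀d 1 = M₀ → f₀dd 1 ≠ 0) :
    IntervalIntegrable
      (fun μ : ℝ => (∫ x in (0:ℝ)..1, (1 - μ * f₀d x)⁻¹) ^ 2)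
      MeasureTheory.volume 0 (1 / M₀) ∧
    ∀ (T : ℝ) (f ρ fx fxx fxt ρt ρx : ℝ → ℝ → ℝ),
      0 < T →
      IsClassicalSol T f ρ fx fxx fxt ρt ρx →
      (∀ x ∈ Icc (0:ℝ) 1, f 0 x = f₀ x ∧ ρ 0 x = ρ₀ x) →
      T ≤ ∫ μ in (0:ℝ)..(1 / M₀), (∫ x in (0:ℝ)..1, (1 - μ * f₀d x)⁻¹) ^ 2 := by
  have hgc : ContinuousOn f₀d (Icc 0 1) := fun x hx =>
    (hf₀dd x hx).continuousAt.continuousWithinAt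
  obtain ⟨c, hc, hlow⟩ := exists_mul_min_le (h := fun x => M₀ - f₀d x) (h' := fun x => -f₀dd x)
    (fun x hx => (hf₀dd x hx).const_sub M₀) (fun x hx => sub_nonneg.2 (hub x hx))
    (fun x hx => sub_pos.2 (honly x hx))
    (fun h => neg_ne_zero.2 (hvort0 (sub_eq_zero.1 h).symm))
    (fun h => neg_ne_zero.2 (hvort1 (sub_eq_zero.1 h).symm))
  have hint := intervalIntegrable_sq_integral_inv hgc hM₀pos hub hc hlow
  refine ⟨hint, fun T f ρ fx fxx fxt ρt ρx hT hs hinit => ?_⟩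
  have hfx0 : ∀ x ∈ Icc (0:ℝ) 1, fx 0 x = f₀d x := fun x hx =>
    (uniqueDiffOn_Icc_zero_one x hx).eq_deriv _
      ((hs.hfx 0 ⟨le_rfl, hT⟩ x hx).hasDerivWithinAt.congr
        (fun y hy => (hinit y hy).1.symm) (hinit x hx).1.symm)
      (hf₀d x hx).hasDerivWithinAt
  have hK : (fun μ : ℝ => (∫ x in (0:ℝ)..1, (1 - μ * f₀d x)⁻¹) ^ 2)
      = fun μ : ℝ => (∫ x in (0:ℝ)..1, (1 - μ * fx 0 x)⁻¹) ^ 2 := by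
    funext μ
    congr 1
    refine intervalIntegral.integral_congr fun x hx => ?_
    rw [uIcc_of_le zero_le_one] at hx
    simp only [hfx0 x hx]
  obtain ⟨a, ha, haM⟩ : ∃ a : ℝ, (a = 0 ∨ a = 1) ∧ fx 0 a = M₀ := by
    rcases hatt with h | h
    · exact ⟨0, Or.inl rfl, by rw [hfx0 0 (by simp), h]⟩
    · exact ⟨1, Or.inr rfl, by rw [hfx0 1 (by simp), h]⟩
  rw [hK] at hint ⊢
  have hbound : ∀ τ ∈ Ico 0 T, τ ≤ _ := fun τ hτ =>
    hs.time_le hτ.1 hτ.2 (fun x hx => by rw [(hinit x hx).2]; exact hρ₀pos x hx) ha hM₀pos haM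
      (fun x hx => (hfx0 x hx).trans_le (hub x hx)) hint
  refine le_of_forall_lt fun τ hτ => ?_
  obtain ⟨σ, hσ, hσT⟩ := exists_between (max_lt hτ hT)
  exact ((le_max_left τ 0).trans_lt hσ).trans_le
    (hbound σ ⟨(le_max_right τ 0).trans hσ.le, hσT⟩)
end

section
/- Let T > 0, let I : [0,T) → ℝ be continuous, let φ₁ : [0,T) → ℝ be twice continuously differentiable with φ₁'' + I φ₁ = 0, φ₁(0) = 1, φ₁'(0) = 0, and φ₁ > 0 on [0,T); let η : [0,T) → ℝ satisfy η' = φ₁^{-2}, η(0) = 0, and set g(t) = ∫₀ᵗ η(s) φ₁(s) ds - η(t) ∫₀ᵗ φ₁(s) ds. Let f₀, ρ₀ : [0,1] → ℝ be twice continuously differentiable, define ω(t,x) = φ₁(t)(1 - f₀'(x) η(t) - ρ₀(x) g(t)), and assume ω(t,x) ≠ 0 on [0,T) × [0,1]. Define h(t,x) = f₀''(x) - ρ₀'(x) ∫₀ᵗ φ₁(s) ds + ( ρ₀'(x) f₀'(x) - ρ₀(x) f₀''(x) ) ∫₀ᵗ η(s) φ₁(s) ds. Then for all (t,x) ∈ [0,T)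 × [0,1], -∂_x ( ∂_t ω(t,x) / ω(t,x) ) = h(t,x) / ω(t,x)². -/
open Set MeasureTheory

open Filter Asymptotics Topology in
/-- A primitive based at a point of continuity where the integrand vanishes has derivative zero
there, with no measurability assumption on the integrand. -/
lemma hasDerivAt_integral_of_continuousAt_of_eq_zero {f : ℝ → ℝ} {a : ℝ}
    (hf : ContinuousAt f a) (ha : f a = 0) :
    HasDerivAt (fun t => ∫ s in a..t, f s) 0 a := by
  rw [hasDerivAt_iff_isLittleO]
  simp only [intervalIntegral.integral_same, sub_zero, smul_zero]
  refine isLittleO_iff.2 fun c hc => ?_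
  obtain ⟨δ, hδ, hb⟩ := Metric.continuousAt_iff.1 hf c hc
  filter_upwards [Metric.ball_mem_nhds a hδ] with t ht
  refine intervalIntegral.norm_integral_le_of_norm_le_const fun s hs => ?_
  have hst : |s - a| ≤ |t - a| := abs_sub_left_of_mem_uIcc (uIoc_subset_uIcc hs)
  have := hb (lt_of_le_of_lt hst ht)
  rw [ha, dist_zero_right] at this
  exact this.le

open Filter Topology in
/-- A primitive based at a point of continuity of the integrand is continuous there, with no
measurability assumption on the integrand. -/
lemma tendsto_integral_of_continuousAt {f : ℝ → ℝ} {a : ℝ} (hf : ContinuousAt f a) :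
    Tendsto (fun t => ∫ s in a..t, f s) (𝓝 a) (𝓝 0) := by
  obtain ⟨δ, hδ, hb⟩ := Metric.continuousAt_iff.1 hf 1 one_pos
  have hlim : Tendsto (fun t => (|f a| + 1) * |t - a|) (𝓝 a) (𝓝 0) := by
    have : Continuous fun t => (|f a| + 1) * |t - a| := by fun_prop
    simpa using this.tendsto a
  refine squeeze_zero_norm' ?_ hlim
  filter_upwards [Metric.ball_mem_nhds a hδ] with t ht
  refine intervalIntegral.norm_integral_le_of_norm_le_const fun s hs => ?_
  have hst : |s - a| ≤ |t - a| := abs_sub_left_of_mem_uIcc (uIoc_subset_uIcc hs)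
  have h1 := hb (lt_of_le_of_lt hst ht)
  rw [Real.dist_eq] at h1
  rw [Real.norm_eq_abs]
  linarith [abs_sub_abs_le_abs_sub (f s) (f a)]

open Filter Asymptotics Topology in
/-- The product of a function differentiable at a zero and a function tending to zero has
derivative zero. -/
lemma hasDerivAt_mul_of_eq_zero_of_tendsto_zero {u v : ℝ → ℝ} {a u' : ℝ}
    (hu : HasDerivAt u u' a) (ha : u a = 0) (hv : Tendsto v (𝓝 a) (𝓝 0)) :
    HasDerivAt (fun t => u t * v t) 0 a := by
  rw [hasDerivAt_iff_isLittleO]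
  have hO : u =O[𝓝 a] fun t => t - a := by simpa [ha] using hu.isBigO_sub
  simpa [ha] using hO.mul_isLittleO ((isLittleO_one_iff ℝ).2 hv)

/-- The fundamental theorem of calculus for a function continuous at every point of `[0, T)`. -/
lemma hasDerivAt_integral_of_continuousAt_Ico {f : ℝ → ℝ} {T t : ℝ}
    (hf : ∀ s ∈ Ico (0:ℝ) T, ContinuousAt f s) (ht : t ∈ Ioo (0:ℝ) T) :
    HasDerivAt (fun t => ∫ s in (0:ℝ)..t, f s) (f t) t := by
  refine intervalIntegral.integral_hasDerivAt_right ?_ ?_ (hf t ⟨ht.1.le, ht.2⟩)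
  · refine ContinuousOn.intervalIntegrable fun s hs => (hf s ?_).continuousWithinAt
    rw [uIcc_of_le ht.1.le] at hs
    exact ⟨hs.1, hs.2.trans_lt ht.2⟩
  · exact ContinuousOn.stronglyMeasurableAtFilter isOpen_Ioo
      (fun s hs => (hf s ⟨hs.1.le, hs.2⟩).continuousWithinAt) t ht

/-- The derivative of `∫₀ᵗ η φ - η(t) ∫₀ᵗ φ` is `-η'(t) ∫₀ᵗ φ` on `[0, T)`. -/
lemma hasDerivAt_integral_mul_sub_mul_integral {φ η η' : ℝ → ℝ} {T t : ℝ}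
    (hφ : ∀ s ∈ Ico (0:ℝ) T, ContinuousAt φ s)
    (hη : ∀ s ∈ Ico (0:ℝ) T, HasDerivAt η (η' s) s) (hη0 : η 0 = 0) (ht : t ∈ Ico (0:ℝ) T) :
    HasDerivAt (fun t => (∫ s in (0:ℝ)..t, η s * φ s) - η t * ∫ s in (0:ℝ)..t, φ s)
      (-(η' t * ∫ s in (0:ℝ)..t, φ s)) t := by
  have hηφ : ∀ s ∈ Ico (0:ℝ) T, ContinuousAt (fun s => η s * φ s) s := fun s hs =>
    (hη s hs).continuousAt.mul (hφ s hs)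
  rcases ht.1.eq_or_lt with rfl | h0
  · have hA := hasDerivAt_integral_of_continuousAt_of_eq_zero (hηφ 0 ht) (by simp [hη0])
    have hB := hasDerivAt_mul_of_eq_zero_of_tendsto_zero (hη 0 ht) hη0
      (tendsto_integral_of_continuousAt (hφ 0 ht))
    simpa using hA.fun_sub hB
  · have hA := hasDerivAt_integral_of_continuousAt_Ico hηφ ⟨h0, ht.2⟩
    have hB := hasDerivAt_integral_of_continuousAt_Ico hφ ⟨h0, ht.2⟩
    exact (hA.fun_sub ((hη t ht).fun_mul hB)).congr_deriv (by ring)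

/-- (Identity (3.38)–(3.39).) With `φ₁` a positive `C²` solution of
`φ₁'' + I φ₁ = 0`, `φ₁(0) = 1`, `φ₁'(0) = 0`, `η' = φ₁⁻²`, `η(0) = 0`,
`g(t) = ∫₀ᵗ η φ₁ ds - η(t) ∫₀ᵗ φ₁ ds`,
`ω(t,x) = φ₁(t)(1 - f₀'(x) η(t) - ρ₀(x) g(t)) ≠ 0`, and
`h(t,x) = f₀''(x) - ρ₀'(x) ∫₀ᵗ φ₁ ds + (ρ₀'(x) f₀'(x) - ρ₀(x) f₀''(x)) ∫₀ᵗ η φ₁ ds`,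
one has `-∂_x(∂_t ω / ω) = h / ω²` on `[0,T) × [0,1]`. -/
theorem stmt16 (T : ℝ) (hT : 0 < T)
    (I φ₁ φ₁d η : ℝ → ℝ)
    (hIcont : ContinuousOn I (Ico (0:ℝ) T))
    (hφ₁d : ∀ t ∈ Ico (0:ℝ) T, HasDerivAt φ₁ (φ₁d t) t)
    (hφ₁dd : ∀ t ∈ Ico (0:ℝ) T, HasDerivAt φ₁d (-(I t * φ₁ t)) t)
    (hφ₁0 : φ₁ 0 = 1) (hφ₁d0 : φ₁d 0 = 0)
    (hφ₁pos : ∀ t ∈ Ico (0:ℝ) T, 0 < φ₁ t)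
    (hη : ∀ t ∈ Ico (0:ℝ) T, HasDerivAt η ((φ₁ t ^ 2)⁻¹) t)
    (hη0 : η 0 = 0)
    (g : ℝ → ℝ)
    (hg : ∀ t : ℝ, g t = (∫ s in (0:ℝ)..t, η s * φ₁ s) - η t * ∫ s in (0:ℝ)..t, φ₁ s)
    (f₀ ρ₀ f₀d f₀dd ρ₀d ρ₀dd : ℝ → ℝ)
    (hf₀d : ∀ x ∈ Icc (0:ℝ) 1, HasDerivAt f₀ (f₀d x) x)
    (hf₀dd : ∀ x ∈ Icc (0:ℝ) 1, HasDerivAt f₀d (f₀dd x) x)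
    (hρ₀d : ∀ x ∈ Icc (0:ℝ) 1, HasDerivAt ρ₀ (ρ₀d x) x)
    (hρ₀dd : ∀ x ∈ Icc (0:ℝ) 1, HasDerivAt ρ₀d (ρ₀dd x) x)
    (hf₀ddc : ContinuousOn f₀dd (Icc (0:ℝ) 1))
    (hρ₀ddc : ContinuousOn ρ₀dd (Icc (0:ℝ) 1))
    (ω : ℝ → ℝ → ℝ)
    (hω : ω = fun t x => φ₁ t * (1 - f₀d x * η t - ρ₀ x * g t))
    (hωne : ∀ t ∈ Ico (0:ℝ) T, ∀ x ∈ Icc (0:ℝ) 1, ω t x ≠ 0)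
    (h : ℝ → ℝ → ℝ)
    (hh : h = fun t x =>
      f₀dd x - ρ₀d x * (∫ s in (0:ℝ)..t, φ₁ s)
        + (ρ₀d x * f₀d x - ρ₀ x * f₀dd x) * ∫ s in (0:ℝ)..t, η s * φ₁ s) :
    ∀ t ∈ Ico (0:ℝ) T, ∀ x ∈ Icc (0:ℝ) 1,
      -(deriv (fun y => (deriv (fun s => ω s y) t) / ω t y) x)
        = h t x / (ω t x) ^ 2 := by
  intro t ht x hx
  have hφ0 : φ₁ t ≠ 0 := (hφ₁pos t ht).ne'
  have hω0 := hωne t ht x hx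
  have hgd : HasDerivAt g (-((φ₁ t ^ 2)⁻¹ * ∫ s in (0:ℝ)..t, φ₁ s)) t := by
    rw [funext hg]
    exact hasDerivAt_integral_mul_sub_mul_integral
      (fun s hs => (hφ₁d s hs).continuousAt) hη hη0 ht
  have hgt := hg t
  subst hω hh
  simp only at hω0 ⊢
  set A := ∫ s in (0:ℝ)..t, η s * φ₁ s
  set B := ∫ s in (0:ℝ)..t, φ₁ s
  have hωt : ∀ y, deriv (fun s => φ₁ s * (1 - f₀d y * η s - ρ₀ y * g s)) t
      = φ₁d t * (1 - f₀d y * η t - ρ₀ y * g t)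
        - φ₁ t * (f₀d y * (φ₁ t ^ 2)⁻¹ - ρ₀ y * ((φ₁ t ^ 2)⁻¹ * B)) := fun y => by
    rw [((hφ₁d t ht).fun_mul ((((hη t ht).const_mul (f₀d y)).const_sub 1).fun_sub
      (hgd.const_mul (ρ₀ y)))).deriv]
    ring
  simp only [hωt]
  have hD : HasDerivAt (fun y => 1 - f₀d y * η t - ρ₀ y * g t)
      (-(f₀dd x * η t) - ρ₀d x * g t) x :=
    (((hf₀dd x hx).mul_const (η t)).const_sub 1).fun_sub ((hρ₀d x hx).mul_const (g t))
  have hN := (hD.const_mul (φ₁d t)).fun_sub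
    ((((hf₀dd x hx).mul_const ((φ₁ t ^ 2)⁻¹)).fun_sub
      ((hρ₀d x hx).mul_const ((φ₁ t ^ 2)⁻¹ * B))).const_mul (φ₁ t))
  rw [(hN.fun_div (hD.const_mul (φ₁ t)) hω0).deriv, ← neg_div]
  congr 1
  rw [hgt]
  field_simp
  ring
end

section
/- Let N₀ ≥ 0, set C₀ = 1 + N₀², and define μ₁ : [0,∞) → ℝ by μ₁(t) = C₀ · ( √C₀ cosh(√C₀ t/2) - N₀ sinh(√C₀ t/2) )^{-2}. Then √C₀ cosh(√C₀ t/2) - N₀ sinh(√C₀ t/2) > 0 for all t ≥ 0 (so μ₁ is well-defined and positive), μ₁(0) = 1, μ₁'(0) = N₀, and μ₁ satisfies the differential equation (d²/dt²)( ln μ₁(t) ) = -μ₁(t)/2 for all t ≥ 0. -/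
open Real

theorem hasDerivAt_cosh_sub_sinh_half (s a b t : ℝ) :
    HasDerivAt (fun t => a * cosh (s * t / 2) - b * sinh (s * t / 2))
      (s / 2 * (a * sinh (s * t / 2) - b * cosh (s * t / 2))) t := by
  have h : HasDerivAt (fun t : ℝ => s * t / 2) (s / 2) t := by
    simpa using ((hasDerivAt_id t).const_mul s).div_const 2
  refine ((h.cosh.const_mul a).sub (h.sinh.const_mul b)).congr_deriv ?_
  ring

theorem mul_cosh_sub_mul_sinh_pos {a b : ℝ} (hb : 0 ≤ b) (hab : b < a) (x : ℝ) :
    0 < a * cosh x - b * sinh x := by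
  have h₁ := mul_pos (sub_pos.2 hab) (cosh_pos x)
  have h₂ := mul_nonneg hb (sub_nonneg.2 (sinh_lt_cosh x).le)
  linarith

/-- (Explicit solution (4.10) of `(ln μ₁)'' = -μ₁/2`.) For `N₀ ≥ 0` and
`C₀ = 1 + N₀²`, the function
`μ₁(t) = C₀ (√C₀ cosh(√C₀ t/2) - N₀ sinh(√C₀ t/2))⁻²` is well defined and positive for
`t ≥ 0`, satisfies `μ₁(0) = 1`, `μ₁'(0) = N₀`, and `(d²/dt²)(ln μ₁(t)) = -μ₁(t)/2` for all
`t ≥ 0`. -/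
theorem stmt18 (N₀ : ℝ) (hN₀ : 0 ≤ N₀) (C₀ : ℝ) (hC₀ : C₀ = 1 + N₀ ^ 2)
    (D μ₁ : ℝ → ℝ)
    (hD : D = fun t => Real.sqrt C₀ * Real.cosh (Real.sqrt C₀ * t / 2)
      - N₀ * Real.sinh (Real.sqrt C₀ * t / 2))
    (hμ₁ : μ₁ = fun t => C₀ * ((D t) ^ 2)⁻¹) :
    (∀ t : ℝ, 0 ≤ t → 0 < D t) ∧
    μ₁ 0 = 1 ∧
    deriv μ₁ 0 = N₀ ∧
    (∀ t : ℝ, 0 ≤ t → deriv (deriv (fun s => Real.log (μ₁ s))) t = -(μ₁ t) / 2) := by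
  have hC : 0 < C₀ := by rw [hC₀]; positivity
  set s := √C₀ with hs
  have hs2 : s ^ 2 = C₀ := sq_sqrt hC.le
  have hs_pos : 0 < s := sqrt_pos.2 hC
  have hNs : N₀ < s := lt_sqrt_of_sq_lt (by linarith)
  have hD_pos (t : ℝ) : 0 < D t := by
    rw [hD]
    exact mul_cosh_sub_mul_sinh_pos hN₀ hNs _
  set F : ℝ → ℝ := fun t => s * sinh (s * t / 2) - N₀ * cosh (s * t / 2) with hF
  have hD' (t : ℝ) : HasDerivAt D (s / 2 * F t) t := by
    rw [hD]
    exact hasDerivAt_cosh_sub_sinh_half s s N₀ t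
  have hF' (t : ℝ) : HasDerivAt F (s / 2 * D t) t := by
    have h := (hasDerivAt_cosh_sub_sinh_half s N₀ s t).neg
    refine (h.congr_deriv ?_).congr_of_eventuallyEq (.of_forall fun x => ?_)
    · simp only [hD]; ring
    · simp only [hF, Pi.neg_apply]; ring
  have hDF (t : ℝ) : D t ^ 2 - F t ^ 2 = 1 := by
    have h := cosh_sq (s * t / 2)
    simp only [hD, hF]
    linear_combination (s ^ 2 - N₀ ^ 2) * h + hs2 + hC₀
  have hD0 : D 0 = s := by simp [hD]
  have hF0 : F 0 = -N₀ := by simp [hF]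
  have hμ' (t : ℝ) : HasDerivAt μ₁ (-C₀ * s * F t / D t ^ 3) t := by
    have hne := (hD_pos t).ne'
    rw [hμ₁]
    refine ((((hD' t).pow 2).inv (pow_ne_zero 2 hne)).const_mul C₀).congr_deriv ?_
    simp only [Pi.pow_apply]
    field_simp
    norm_num
    ring
  have hμ_pos (t : ℝ) : 0 < μ₁ t := by
    have := hD_pos t
    rw [hμ₁]
    positivity
  have hlog : deriv (fun x => log (μ₁ x)) = fun t => -s * F t / D t := by
    funext t
    have hne := (hD_pos t).ne'
    rw [((hμ' t).log (hμ_pos t).ne').deriv, hμ₁]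
    field_simp
  refine ⟨fun t _ => hD_pos t, ?_, ?_, fun t _ => ?_⟩
  · simp only [hμ₁, hD0, hs2]
    exact mul_inv_cancel₀ hC.ne'
  · rw [(hμ' 0).deriv, hD0, hF0, ← hs2]
    field_simp
  · have hne := (hD_pos t).ne'
    rw [hlog, (((hF' t).const_mul (-s)).fun_div (hD' t) hne).deriv, hμ₁]
    field_simp
    linear_combination -s ^ 2 * hDF t - hs2
end
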